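/- For every integer k ≥ 2 and every constant γ > 0 there exist constants c₁, c₂ > 0 and n₀ ∈ ℕ such that for all n ≥ n₀, every k-graph G on n vertices with δ(G) ≥ (1/2 + γ)n contains at least exp(n ln n − c₂ n) and at most exp(n ln n − c₁ n) distinct tight Hamilton cycles. -/

import Mathlib

open scoped Classical

/-- The set of tight Hamilton cycles of the `k`-graph on vertex set `Fin n` with edge
set `E`: each tight Hamilton cycle is encoded as its edge set, a subset of `E` whose
edges are exactly the sets of `k` cyclically consecutive vertices with respect to some
cyclic ordering (i.e. bijective enumeration) `v` of all the vertices. -/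
noncomputable def tightHamCycles (n k : ℕ) (E : Finset (Finset (Fin n))) :
    Finset (Finset (Finset (Fin n))) :=
  E.powerset.filter (fun C =>
    ∃ v : Fin n → Fin n, Function.Bijective v ∧
      C = Finset.image (fun i : Fin n =>
            Finset.image (fun j : Fin k =>
              v ⟨((i : ℕ) + (j : ℕ)) % n, Nat.mod_lt _ i.pos⟩) Finset.univ)
          Finset.univ)

namespace TightHam

/-- Every `k` consecutive entries of the list form an edge. -/
def Tight {V : Type} [DecidableEq V] (k : ℕ) (E : Finset V → Prop) (l : List V) : Prop :=
  ∀ w, w <:+: l → w.length = k → E w.toFinset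

section Tight

variable {V : Type} [DecidableEq V] {k : ℕ} {E : Finset V → Prop}

theorem Tight.of_infix {l l' : List V} (h : Tight k E l) (hl : l' <:+: l) : Tight k E l' :=
  fun w hw => h w (hw.trans hl)

theorem Tight.left {a b : List V} (h : Tight k E (a ++ b)) : Tight k E a :=
  h.of_infix (List.prefix_append a b).isInfix

theorem tight_of_length_lt {l : List V} (h : l.length < k) : Tight k E l :=
  fun w hw hk => absurd hw.length_le (by omega)

theorem tight_of_length_eq {l : List V} (h : l.length = k) (hl : E l.toFinset) : Tight k E l := by
  intro w hw hk
  rwa [hw.eq_of_length (by omega)]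

theorem Tight.append {a m b : List V} (hm : k ≤ m.length + 1) (h1 : Tight k E (a ++ m))
    (h2 : Tight k E (m ++ b)) : Tight k E (a ++ m ++ b) := by
  induction a with
  | nil => simpa using h2
  | cons c a ih =>
    intro w hw hk
    rw [List.cons_append, List.cons_append, List.infix_cons_iff] at hw
    rcases hw with hw | hw
    · refine h1 w (List.IsPrefix.isInfix ?_) hk
      refine List.prefix_of_prefix_length_le hw (by simp) (by simp; omega)
    · exact ih (h1.of_infix (by simpa using (List.suffix_cons c (a ++ m)).isInfix)) w hw hk

theorem Tight.append_of_suffix {p s m : List V} (hs : s <:+ p) (hk : k ≤ s.length + 1)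
    (h1 : Tight k E p) (h2 : Tight k E (s ++ m)) : Tight k E (p ++ m) := by
  obtain ⟨a, rfl⟩ := hs
  exact Tight.append hk h1 h2

theorem Tight.append_of_prefix {p s m : List V} (hs : s <+: p) (hk : k ≤ s.length + 1)
    (h1 : Tight k E p) (h2 : Tight k E (m ++ s)) : Tight k E (m ++ p) := by
  obtain ⟨a, rfl⟩ := hs
  rw [← List.append_assoc]
  exact Tight.append hk h2 h1

/-- Appending a single vertex. -/
theorem Tight.concat {l s : List V} {v : V} (hs : s <:+ l) (hk : s.length + 1 = k)
    (h1 : Tight k E l) (h2 : E (insert v s.toFinset)) : Tight k E (l ++ [v]) := by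
  refine h1.append_of_suffix hs (by omega) (tight_of_length_eq (by simpa using hk) ?_)
  convert h2 using 1
  ext; simp

/-- Prepending a single vertex. -/
theorem Tight.cons {l s : List V} {v : V} (hs : s <+: l) (hk : s.length + 1 = k)
    (h1 : Tight k E l) (h2 : E (insert v s.toFinset)) : Tight k E (v :: l) := by
  have : Tight k E ([v] ++ l) := by
    refine h1.append_of_prefix hs (by omega) (tight_of_length_eq (by simp; omega) ?_)
    simpa using h2
  simpa using this

/-- Every window of `C ++ C` of length `C.length` is a cyclic rotation of `C`. -/
theorem tight_append_self {C : List V} (hC : C.length = k) (h : E C.toFinset) :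
    Tight k E (C ++ C) := by
  rintro w ⟨s, t, hst⟩ hk
  have hlen := congrArg List.length hst
  simp at hlen
  have hw : w = ((C ++ C).drop s.length).take k := by
    rw [← hst]; simp [← hk]
  have hs : s.length ≤ C.length := by omega
  have : w.toFinset = C.toFinset := by
    rw [hw, List.drop_append_of_le_length hs, List.take_append]
    rw [List.take_of_length_le (by simp; omega)]
    have : k - (C.drop s.length).length = s.length := by simp; omega
    rw [this]
    ext x
    have hx : x ∈ C ↔ x ∈ C.take s.length ++ C.drop s.length := by rw [List.take_append_drop]
    simp only [List.mem_toFinset, hx, List.mem_append, or_comm]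
  rwa [this]

theorem tight_flatten_replicate {C : List V} (hC : C.length = k) (h : E C.toFinset) (t : ℕ) :
    Tight k E (List.replicate t C).flatten := by
  induction t with
  | zero => intro w hw hk; simp at hw; subst hw; simp at hk; subst hk; simp at hC; subst hC; exact h
  | succ t ih =>
    rcases t with _ | t
    · simpa using tight_of_length_eq hC h
    · rw [List.replicate_succ, List.flatten_cons]
      refine ih.append_of_prefix (s := C) (by simp [List.replicate_succ]) (by omega)
        (tight_append_self hC h)

/-- A tight walk can be traversed back to its starting tuple, by going around its edges. -/
theorem exists_tight_return {a s : List V} (hs : s.length + 1 = k) (h : Tight k E (a ++ s)) :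
    ∃ m, m.length = (k - 1) * a.length ∧ (∀ v ∈ m, v ∈ a ++ s) ∧ Tight k E (s ++ m) ∧
      (a ++ s).take (k - 1) <:+ s ++ m := by
  induction a with
  | nil =>
    refine ⟨[], by simp, by simp, by simpa using h, ?_⟩
    simp only [List.nil_append, List.append_nil]
    rw [List.take_of_length_le (by omega)]
  | cons c a ih =>
    obtain ⟨m, hm, hms, ht, r, hr⟩ := ih (h.of_infix (List.suffix_cons c (a ++ s)).isInfix)
    set p := (a ++ s).take (k - 1) with hp
    have hpl : p.length + 1 = k := by simp [hp]; omega
    have hedge : E (c :: p).toFinset := by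
      refine h (c :: p) (List.IsPrefix.isInfix ?_) (by simpa using hpl)
      simpa using List.take_prefix _ _
    have hcp : (c :: a ++ s).take (k - 1) = (c :: p).take (k - 1) := by
      obtain ⟨j, hj⟩ : ∃ j, k - 1 = j + 1 ∨ k - 1 = 0 := ⟨k - 2, by omega⟩
      rcases hj with hj | hj
      · rw [hp, hj]; simp [List.take_take]
      · simp [hj]
    refine ⟨m ++ (c :: p).take (k - 1), ?_, ?_, ?_, ?_⟩
    · simp [hm]; rw [min_eq_left (by omega)]; ring
    · intro v hv
      rcases List.mem_append.1 hv with hv | hv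
      · have := hms v hv; simp at this ⊢; tauto
      · have := List.mem_of_mem_take (hcp ▸ hv); simpa using this
    · rw [← List.append_assoc]
      refine ht.append_of_suffix ⟨r, hr⟩ (by omega) ?_
      have hrot : E (p ++ [c]).toFinset := by
        convert hedge using 1; ext; simp
      have := tight_append_self (C := p ++ [c]) (by simpa using hpl) hrot
      refine this.of_infix (List.IsPrefix.isInfix ?_)
      simp only [List.append_assoc, List.prefix_append_right_inj]
      refine (List.take_prefix _ _).trans ?_
      simp
    · rw [hcp, ← List.append_assoc]
      exact List.suffix_append _ _

end Tight

theorem card_cons {α : Type} [Fintype α] (f : ℕ) (C : (Fin (f + 1) → α) → Prop)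
    [DecidablePred C] :
    (Finset.univ.filter C).card = ∑ x : α, (Finset.univ.filter
      (fun p : Fin f → α => C (Fin.cons x p))).card := by
  simp only [Finset.card_filter]
  rw [← (Fin.consEquiv (fun _ => α)).sum_comp, Fintype.sum_prod_type]
  rfl

theorem card_cons_comm {α : Type} [Fintype α] (f : ℕ) (C : (Fin (f + 1) → α) → Prop) :
    (Finset.univ.filter C).card = ∑ p : Fin f → α, (Finset.univ.filter
      (fun x : α => C (Fin.cons x p))).card := by
  simp only [Finset.card_filter]
  rw [← (Fin.consEquiv (fun _ => α)).sum_comp, Fintype.sum_prod_type_right]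
  rfl

/-- Number of sequences built one element at a time with at least `c` choices at each step. -/
theorem pow_le_card_seq {α : Type} [Fintype α] (P : List α → Prop) {c : ℝ} (hc : 0 ≤ c) (f : ℕ)
    (h0 : P []) (h : ∀ l, P l → l.length < f → c ≤ (Finset.univ.filter (fun a => P (a :: l))).card) :
    c ^ f ≤ (Finset.univ.filter (fun a : Fin f → α => P (List.ofFn a))).card := by
  induction f with
  | zero =>
    simp [h0]
  | succ f ih =>
    have ih := ih (fun l hl hlf => h l hl (by omega))
    rw [card_cons_comm]
    push_cast
    calc c ^ (f + 1) = c ^ f * c := pow_succ _ _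
      _ ≤ (Finset.univ.filter (fun a : Fin f → α => P (List.ofFn a))).card * c := by gcongr
      _ = ∑ p ∈ Finset.univ.filter (fun a : Fin f → α => P (List.ofFn a)), c := by simp
      _ ≤ ∑ p ∈ Finset.univ.filter (fun a : Fin f → α => P (List.ofFn a)),
            ((Finset.univ.filter (fun x : α => P (List.ofFn (Fin.cons x p : Fin (f+1) → α)))).card : ℝ) := by
          refine Finset.sum_le_sum fun p hp => ?_
          have := h (List.ofFn p) (by simpa using hp) (by simp)
          simpa [List.ofFn_cons] using this
      _ ≤ _ := Finset.sum_le_sum_of_subset_of_nonneg (Finset.filter_subset _ _)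
            (fun _ _ _ => by positivity)

/-- Counting version of the Kővári–Sós–Turán–Erdős theorem: the number of `t`-fold blow-ups all of
whose transversals satisfy `C`. -/
theorem density_pow_le_card_blowup {α : Type} [Fintype α] [Nonempty α] (t : ℕ) (ht : 0 < t) (f : ℕ)
    (C : (Fin f → α) → Prop) :
    ((Finset.univ.filter C).card / (Fintype.card α : ℝ) ^ f) ^ t ^ f *
        ((Fintype.card α : ℝ) ^ t) ^ f ≤
      (Finset.univ.filter (fun φ : Fin f → Fin t → α =>
        ∀ σ : Fin f → Fin t, C (fun i => φ i (σ i)))).card := by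
  have hu : (0 : ℝ) < Fintype.card α := by exact_mod_cast Fintype.card_pos
  set u : ℝ := (Fintype.card α : ℝ) with hu'
  induction f with
  | zero =>
    simp only [pow_zero, div_one, pow_one, mul_one]
    have : ∀ a b : Fin 0 → α, C a → C b := fun a b h => by rwa [Subsingleton.elim b a]
    by_cases h : C Fin.elim0
    · have e1 : (Finset.univ.filter C) = Finset.univ :=
        Finset.filter_true_of_mem (fun a _ => this _ _ h)
      have e2 : (Finset.univ.filter (fun φ : Fin 0 → Fin t → α =>
        ∀ σ : Fin 0 → Fin t, C (fun i => φ i (σ i)))) = Finset.univ :=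
        Finset.filter_true_of_mem (fun a _ σ => this _ _ h)
      rw [e1, e2]; simp
    · have e1 : (Finset.univ.filter C) = ∅ :=
        Finset.filter_false_of_mem (fun a _ ha => h (this _ _ ha))
      rw [e1]; simp
  | succ f ih =>
    rw [card_cons f (fun φ : Fin (f+1) → Fin t → α => ∀ σ : Fin (f+1) → Fin t, C (fun i => φ i (σ i)))]
    push_cast
    have key : ∀ x : Fin t → α,
        (((Finset.univ.filter (fun p : Fin f → α => ∀ j, C (Fin.cons (x j) p))).card : ℝ) / u ^ f)
            ^ t ^ f * (u ^ t) ^ f ≤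
        ((Finset.univ.filter (fun p : Fin f → Fin t → α =>
          ∀ σ : Fin (f+1) → Fin t, C (fun i => (Fin.cons x p : Fin (f+1) → Fin t → α) i (σ i)))).card : ℝ) := by
      intro x
      refine (le_trans (le_of_eq (by congr!)) (ih (fun p => ∀ j, C (Fin.cons (x j) p)))).trans ?_
      refine Nat.cast_le.2 (Finset.card_le_card fun p hp => ?_)
      simp only [Finset.mem_filter, Finset.mem_univ, true_and] at hp ⊢
      intro σ
      convert hp (fun i => σ i.succ) (σ 0) using 1
      ext i
      refine Fin.cases ?_ (fun i => ?_) i <;> simp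
    refine le_trans ?_ (Finset.sum_le_sum fun x _ => key x)
    rw [← Finset.sum_mul]
    set d : (Fin f → α) → ℝ := fun p => (Finset.univ.filter (fun x : α => C (Fin.cons x p))).card
    have hd : ((Finset.univ.filter C).card : ℝ) = ∑ p, d p := by
      rw [card_cons_comm]; push_cast; rfl
    have hdt : ∑ x : Fin t → α,
        ((Finset.univ.filter (fun p : Fin f → α => ∀ j, C (Fin.cons (x j) p))).card : ℝ) =
        ∑ p, d p ^ t := by
      simp only [Finset.card_filter, d]
      push_cast
      rw [Finset.sum_comm]
      refine Finset.sum_congr rfl fun p _ => ?_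
      rw [Finset.sum_pow']
      simp only [Fintype.piFinset_univ, Finset.prod_ite_zero]
      refine Finset.sum_congr rfl fun x _ => ?_
      simp
    have mean_pow : ∀ {ι : Type} [Fintype ι] (g : ι → ℝ) (n : ℕ), (∀ i, 0 ≤ g i) → 0 < n →
        0 < Fintype.card ι →
        (Fintype.card ι : ℝ) * ((∑ i, g i) / Fintype.card ι) ^ n ≤ ∑ i, g i ^ n := by
      intro ι _ g n hg hn hι
      obtain ⟨s, rfl⟩ : ∃ s, n = s + 1 := ⟨n - 1, by omega⟩
      have := pow_sum_div_card_le_sum_pow (s := Finset.univ) (f := g) (fun i _ => hg i) s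
      refine le_trans (le_of_eq ?_) this
      have : (0 : ℝ) < Fintype.card ι := by exact_mod_cast hι
      rw [div_pow, pow_succ (Fintype.card ι : ℝ), Finset.card_univ]
      field_simp
    have j1 := mean_pow d t (fun p => Nat.cast_nonneg _) ht (by simp [Fintype.card_pos])
    have j2 := mean_pow (fun x : Fin t → α => ((Finset.univ.filter
      (fun p : Fin f → α => ∀ j, C (Fin.cons (x j) p))).card : ℝ) / u ^ f) (t ^ f)
      (fun p => by positivity) (by positivity) (by simp [Fintype.card_pos])
    rw [← Finset.sum_div, hdt] at j2
    simp only [Fintype.card_pi, Finset.prod_const, Finset.card_univ, Fintype.card_fin,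
      Nat.cast_pow, ← hu'] at j1 j2
    rw [← hd] at j1
    set N : ℝ := ((Finset.univ.filter C).card : ℝ)
    have hN : 0 ≤ N := Nat.cast_nonneg _
    calc (N / u ^ (f + 1)) ^ t ^ (f + 1) * (u ^ t) ^ (f + 1)
        = (u ^ t * ((u ^ f * (N / u ^ f) ^ t) / u ^ f / u ^ t) ^ t ^ f) * (u ^ t) ^ f := by
          have : (u ^ f * (N / u ^ f) ^ t) / u ^ f / u ^ t = (N / u ^ (f + 1)) ^ t := by
            rw [pow_succ, ← div_div, div_pow (N / u ^ f)]
            field_simp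
          rw [this, pow_succ' t, pow_mul, pow_succ (u ^ t)]
          ring
      _ ≤ (u ^ t * ((∑ p, d p ^ t) / u ^ f / u ^ t) ^ t ^ f) * (u ^ t) ^ f := by
          gcongr
      _ ≤ _ := by
          gcongr

theorem exists_blowup (f t : ℕ) (ht : 0 < t) {c : ℝ} (hc : 0 < c) : ∃ u₀ : ℕ,
    ∀ {V : Type} [DecidableEq V] (U : Finset V) (P : List V → Prop), u₀ ≤ U.card → P [] →
    (∀ l, P l → (∀ v ∈ l, v ∈ U) → l.length < f →
      c * U.card ≤ (U.filter (fun v => P (v :: l))).card) →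
    ∃ φ : Fin f → ℕ → V, (∀ i j, φ i j ∈ U) ∧
      (∀ i i' j j', j < t → j' < t → φ i j = φ i' j' → i = i' ∧ j = j') ∧
      ∀ σ : Fin f → ℕ, (∀ i, σ i < t) → P (List.ofFn fun i => φ i (σ i)) := by
  set N := f * t with hN
  set ε : ℝ := (c ^ f) ^ t ^ f with hε
  have hε0 : 0 < ε := by positivity
  refine ⟨N + 1 + ⌈(N ^ 2 + 1 : ℝ) / ε⌉₊, ?_⟩
  intro V _ U P hU h0 h
  have hu1 : (N : ℝ) + 1 ≤ U.card := by
    have : N + 1 ≤ U.card := by omega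
    exact_mod_cast this
  have hu2 : (N ^ 2 + 1 : ℝ) / ε ≤ U.card := by
    refine (Nat.le_ceil _).trans ?_
    exact_mod_cast (by omega : ⌈(N ^ 2 + 1 : ℝ) / ε⌉₊ ≤ U.card)
  have hupos : (0 : ℝ) < U.card := by
    have : (0 : ℝ) ≤ N := Nat.cast_nonneg _
    linarith
  have : Nonempty U := by
    rw [Finset.nonempty_coe_sort, ← Finset.card_pos]; exact_mod_cast hupos
  have hcard : Fintype.card U = U.card := Fintype.card_coe U
  set C : (Fin f → U) → Prop := fun a => P ((List.ofFn a).map Subtype.val) with hC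
  have hseq := pow_le_card_seq (α := U) (fun l => P (l.map Subtype.val)) (c := c * U.card)
    (by positivity) f h0 (by
      intro l hl hlf
      refine (h _ hl (fun v hv => by
        obtain ⟨a, -, rfl⟩ := List.mem_map.1 hv; exact a.2) (by simpa using hlf)).trans (le_of_eq ?_)
      congr 1
      refine (Finset.card_bij (fun a _ => a.1) ?_ ?_ ?_).symm
      · intro a ha; simpa using ha
      · intro a _ b _ hab; exact Subtype.ext hab
      · intro b hb
        simp only [Finset.mem_filter] at hb
        exact ⟨⟨b, hb.1⟩, by simpa using hb.2, rfl⟩)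
  have hkst := density_pow_le_card_blowup t ht f C
  rw [hcard] at hkst
  set good := Finset.univ.filter (fun φ : Fin f → Fin t → U =>
        ∀ σ : Fin f → Fin t, C (fun i => φ i (σ i)))
  have hgood : ε * (U.card : ℝ) ^ N ≤ good.card := by
    refine le_trans ?_ hkst
    rw [hN, mul_comm f t, pow_mul, hε]
    gcongr
    rw [le_div_iff₀ (by positivity), ← mul_pow]
    exact hseq
  set inj := Finset.univ.filter (fun φ : Fin f → Fin t → U =>
    Function.Injective (Function.uncurry φ))
  have hinj : (U.card : ℝ) ^ N * (1 - N * (N / U.card)) ≤ inj.card := by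
    have e1 : inj.card = U.card.descFactorial N := by
      rw [← hcard, hN]
      have := Fintype.card_embedding_eq (α := Fin f × Fin t) (β := U)
      simp only [Fintype.card_prod, Fintype.card_fin] at this
      rw [← this, ← Fintype.card_congr (Equiv.subtypeInjectiveEquivEmbedding _ _),
        Fintype.card_subtype]
      refine Finset.card_equiv (Equiv.curry _ _ _).symm ?_
      intro φ
      simp [inj]
    have e2 := Nat.pow_sub_le_descFactorial U.card N
    have e3 : ((U.card : ℝ) - N) ^ N ≤ ((U.card + 1 - N : ℕ) : ℝ) ^ N := by
      rw [Nat.cast_sub (by exact_mod_cast (by linarith : (N : ℝ) ≤ U.card + 1))]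
      push_cast
      gcongr
      · linarith
      · linarith
    have e4 : (1 : ℝ) + N * (-(N / U.card)) ≤ (1 + (-(N / U.card))) ^ N :=
      one_add_mul_le_pow (by
        have : (N : ℝ) / U.card ≤ 1 := by rw [div_le_one hupos]; linarith
        linarith) N
    calc (U.card : ℝ) ^ N * (1 - N * (N / U.card))
        ≤ (U.card : ℝ) ^ N * (1 + (-(N / U.card))) ^ N := by
          gcongr; linarith
      _ = ((U.card : ℝ) - N) ^ N := by
          rw [← mul_pow]; congr 1; field_simp; ring
      _ ≤ _ := e3
      _ ≤ inj.card := by rw [e1]; exact_mod_cast e2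
  have hex : ∃ φ, φ ∈ good ∧ φ ∈ inj := by
    by_contra hcon
    push Not at hcon
    have hd : Disjoint good inj := Finset.disjoint_left.2 hcon
    have h1 : good.card + inj.card ≤ U.card ^ N := by
      rw [← Finset.card_union_of_disjoint hd]
      refine (Finset.card_le_univ _).trans (le_of_eq ?_)
      simp [hN, ← pow_mul, mul_comm]
    have h2 : (good.card : ℝ) + inj.card ≤ (U.card : ℝ) ^ N := by exact_mod_cast h1
    have h3 : (U.card : ℝ) ^ N * (ε - N * (N / U.card)) ≤ 0 := by linarith
    have h4 : 0 < ε - N * (N / U.card) := by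
      rw [div_le_iff₀ hε0] at hu2
      rw [sub_pos, ← mul_div_assoc, div_lt_iff₀ hupos]
      nlinarith
    have h5 : 0 < (U.card : ℝ) ^ N * (ε - N * (N / U.card)) := by positivity
    linarith
  obtain ⟨φ, hφ, hφi⟩ := hex
  simp only [good, inj, Finset.mem_filter, Finset.mem_univ, true_and] at hφ hφi
  refine ⟨fun i j => (φ i ⟨j % t, Nat.mod_lt _ ht⟩ : U), fun i j => by simp, ?_, ?_⟩
  · intro i i' j j' hj hj' heq
    have := @hφi (i, ⟨j % t, Nat.mod_lt _ ht⟩) (i', ⟨j' % t, Nat.mod_lt _ ht⟩) (Subtype.ext heq)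
    simpa [Nat.mod_eq_of_lt hj, Nat.mod_eq_of_lt hj'] using this
  · intro σ hσ
    have := hφ (fun i => ⟨σ i % t, Nat.mod_lt _ ht⟩)
    simp only [hC, List.map_ofFn] at this
    exact this

/-- The realisation of a word of labels: the label `Sum.inl a` stands for the vertex `a`, and
`Sum.inr i` at position `p` for the `p`-th copy of the blown-up vertex `i`. -/
def realize {V ι : Type} (φ : ι → ℕ → V) (W : List (V ⊕ ι)) : List V :=
  W.zipIdx.map (fun p => Sum.elim (fun a _ => a) φ p.1 p.2)

/-- A set of labels that is an edge whichever copies (among the first `t`) are chosen. -/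
def LabelEdge {V ι : Type} [DecidableEq V] (k t : ℕ) (E : Finset V → Prop) (φ : ι → ℕ → V)
    (e : Finset (V ⊕ ι)) : Prop :=
  e.card = k ∧ ∀ σ : ι → ℕ, (∀ i, σ i < t) → E (e.image (Sum.elim id (fun i => φ i (σ i))))

section

variable {V ι : Type} [DecidableEq V] [DecidableEq ι] {k t : ℕ} {E : Finset V → Prop}
  {φ : ι → ℕ → V}

theorem nodup_of_card_toFinset {α : Type} [DecidableEq α] {l : List α}
    (h : l.toFinset.card = l.length) : l.Nodup := by
  rw [List.card_toFinset] at h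
  rw [← List.dedup_eq_self]
  exact (List.dedup_sublist l).eq_of_length h

theorem tight_realize {W : List (V ⊕ ι)} (ht : 0 < t) (hW : W.length ≤ t)
    (h : Tight k (LabelEdge k t E φ) W) : Tight k E (realize φ W) := by
  rintro w hw hk
  obtain ⟨w', hw', rfl⟩ := List.infix_map_iff.1 hw
  have h1 : w'.map Prod.fst <:+: W := by
    have := hw'.map Prod.fst
    rwa [List.zipIdx_map_fst] at this
  obtain ⟨hc, hE⟩ := h _ h1 (by simpa using hk)
  have hnd : (w'.map Prod.fst).Nodup := nodup_of_card_toFinset (by rw [hc]; simpa using hk.symm)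
  have hex : ∀ i, ∃ p, p < t ∧ ∀ q, (Sum.inr i, q) ∈ w' → q = p := by
    intro i
    by_cases hi : ∃ p, (Sum.inr i, p) ∈ w'
    · obtain ⟨p, hp⟩ := hi
      have := List.snd_lt_of_mem_zipIdx (hw'.subset hp)
      refine ⟨p, by simp at this; omega, fun q hq => ?_⟩
      have := List.inj_on_of_nodup_map hnd hq hp rfl
      simpa using this
    · exact ⟨0, ht, fun q hq => (hi ⟨q, hq⟩).elim⟩
  choose σ hσ hσ' using hex
  convert hE σ hσ using 1
  ext v
  simp only [List.mem_toFinset, List.mem_map, Finset.mem_image, Prod.exists]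
  constructor
  · rintro ⟨b, p, hb, rfl⟩
    refine ⟨b, ⟨b, p, hb, rfl⟩, ?_⟩
    rcases b with a | i
    · rfl
    · simp [hσ' i p hb]
  · rintro ⟨b, ⟨b', p, hb, hbb⟩, rfl⟩
    obtain rfl : b' = b := hbb
    refine ⟨b', p, hb, ?_⟩
    rcases b' with a | i
    · rfl
    · simp [hσ' i p hb]

end

section

variable {V ι : Type} {t : ℕ} {φ : ι → ℕ → V}

/-- The word of distinct copies realising a word of blown-up vertices, starting at position `p`. -/
def copies (φ : ι → ℕ → V) (p : ℕ) (I : List ι) : List V :=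
  (I.zipIdx p).map (fun q => φ q.1 q.2)

theorem length_copies (p : ℕ) (I : List ι) : (copies φ p I).length = I.length := by
  simp [copies]

theorem mem_copies {p : ℕ} {I : List ι} {v : V} (h : v ∈ copies φ p I) :
    ∃ i ∈ I, ∃ j, v = φ i j := by
  obtain ⟨⟨i, j⟩, hq, rfl⟩ := List.mem_map.1 h
  exact ⟨i, List.fst_mem_of_mem_zipIdx hq, j, rfl⟩

theorem nodup_copies {p : ℕ} {I : List ι} (hI : p + I.length ≤ t)
    (hφ : ∀ i i' j j', j < t → j' < t → φ i j = φ i' j' → i = i' ∧ j = j') :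
    (copies φ p I).Nodup := by
  refine List.Nodup.map_on ?_ ?_
  · rintro ⟨i, j⟩ h ⟨i', j'⟩ h' heq
    have := List.snd_lt_add_of_mem_zipIdx h
    have := List.snd_lt_add_of_mem_zipIdx h'
    obtain ⟨rfl, rfl⟩ := hφ i i' j j' (by simp at *; omega) (by simp at *; omega) heq
    rfl
  · refine List.Nodup.of_map Prod.snd ?_
    rw [List.zipIdx_map_snd]
    exact List.nodup_range'

theorem sum_copies_le {p : ℕ} {I : List ι} (w : V → ℝ) (g : ι → ℝ)
    (hI : p + I.length ≤ t) (h : ∀ i j, j < t → w (φ i j) ≤ g i) : ((copies φ p I).map w).sum ≤ (I.map g).sum := by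
  induction I generalizing p with
  | nil => simp [copies]
  | cons i I ih =>
    rw [List.length_cons] at hI
    have := ih (p := p + 1) (by omega)
    simp only [copies, List.zipIdx_cons, List.map_cons, List.sum_cons] at this ⊢
    exact add_le_add (h _ _ (by omega)) this

theorem realize_sandwich (x y : List V) (I : List ι) :
    realize φ (x.map Sum.inl ++ I.map Sum.inr ++ y.map Sum.inl) =
      x ++ copies φ x.length I ++ y := by
  have h : ∀ (z : List V) (p : ℕ), ((z.map (Sum.inl : V → V ⊕ ι)).zipIdx p).map
      (fun p => Sum.elim (fun a _ => a) φ p.1 p.2) = z := by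
    intro z
    induction z with
    | nil => simp
    | cons a z ih => intro p; simp [ih]
  have h' : ∀ p, ((I.map (Sum.inr : ι → V ⊕ ι)).zipIdx p).map
      (fun p => Sum.elim (fun a _ => a) φ p.1 p.2) = copies φ p I := by
    induction I with
    | nil => simp [copies]
    | cons a z ih => intro p; simp [copies] at ih ⊢; simp [ih]
  simp only [realize, List.zipIdx_append, List.map_append, h, h', List.length_append,
    List.length_map, zero_add]

end

/-- The vertices of `U` completing `S` to an edge. -/
noncomputable def nbr {V : Type} [DecidableEq V] (E : Finset V → Prop) (S U : Finset V) :
    Finset V :=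
  U.filter (fun v => E (insert v S))

/-- Every `(k - 1)`-subset of `W` has relative codegree at least `η` into `U`. -/
def Good {V : Type} [DecidableEq V] (k : ℕ) (E : Finset V → Prop) (η : ℝ) (W U : Finset V) :
    Prop :=
  ∀ S ⊆ W, S.card = k - 1 → η * U.card ≤ (nbr E S U).card

section

variable {V : Type} [DecidableEq V] {k : ℕ} {E : Finset V → Prop} {W U : Finset V} {γ : ℝ}

theorem Good.two_mul_le_card_inter (h : Good k E (1 / 2 + γ) W U) {S T : Finset V} (hS : S ⊆ W)
    (hT : T ⊆ W) (hSk : S.card = k - 1) (hTk : T.card = k - 1) :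
    2 * γ * U.card ≤ (nbr E S U ∩ nbr E T U).card := by
  have h1 := h S hS hSk
  have h2 := h T hT hTk
  have h3 := Finset.card_union_add_card_inter (nbr E S U) (nbr E T U)
  have h4 : (nbr E S U ∪ nbr E T U).card ≤ U.card :=
    Finset.card_le_card (Finset.union_subset (Finset.filter_subset _ _) (Finset.filter_subset _ _))
  have h3' : ((nbr E S U ∪ nbr E T U).card : ℝ) + (nbr E S U ∩ nbr E T U).card =
      (nbr E S U).card + (nbr E T U).card := by exact_mod_cast h3
  have h4' : ((nbr E S U ∪ nbr E T U).card : ℝ) ≤ U.card := by exact_mod_cast h4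
  linarith

theorem Good.le_card_filter (h : Good k E (1 / 2 + γ) W U) {S T : Finset V} (hS : S ⊆ W)
    (hT : T ⊆ W) (hSk : S.card = k - 1) (hTk : T.card = k - 1) (l : List V) :
    2 * γ * U.card - l.length ≤
      (U.filter (fun v => v ∉ l ∧ E (insert v S) ∧ E (insert v T))).card := by
  have h1 := h.two_mul_le_card_inter hS hT hSk hTk
  have h2 : nbr E S U ∩ nbr E T U ⊆
      U.filter (fun v => v ∉ l ∧ E (insert v S) ∧ E (insert v T)) ∪ l.toFinset := by
    intro v hv
    simp only [nbr, Finset.mem_inter, Finset.mem_filter] at hv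
    by_cases hvl : v ∈ l <;> simp [hvl, hv]
  have h3 := (Finset.card_le_card h2).trans (Finset.card_union_le _ _)
  have h4 := l.toFinset_card_le
  have h5 : ((nbr E S U ∩ nbr E T U).card : ℝ) ≤
    (U.filter (fun v => v ∉ l ∧ E (insert v S) ∧ E (insert v T))).card + l.length := by
    exact_mod_cast h3.trans (by omega)
  linarith

theorem tight_labelEdge {ι : Type} [DecidableEq ι] {t : ℕ} {φ : ι → ℕ → V} {L : List (V ⊕ ι)}
    (hL : L.Nodup)
    (h : ∀ σ : ι → ℕ, (∀ i, σ i < t) → Tight k E (L.map (Sum.elim id (fun i => φ i (σ i))))) :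
    Tight k (LabelEdge k t E φ) L := by
  intro w hw hk
  refine ⟨by rw [List.toFinset_card_of_nodup (hL.sublist hw.sublist), hk], fun σ hσ => ?_⟩
  have := h σ hσ (w.map (Sum.elim id (fun i => φ i (σ i)))) (hw.map _) (by simpa using hk)
  convert this using 1
  ext; simp

theorem exists_map_inr {α β : Type} (m : List (α ⊕ β)) (h : ∀ v ∈ m, ∃ i, v = Sum.inr i) :
    ∃ I : List β, m = I.map Sum.inr := by
  induction m with
  | nil => exact ⟨[], rfl⟩
  | cons a m ih =>
    obtain ⟨i, rfl⟩ := h a (by simp)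
    obtain ⟨I, rfl⟩ := ih (fun v hv => h v (by simp [hv]))
    exact ⟨i :: I, rfl⟩

theorem card_toFinset_of_infix {l w : List V} (h : l.Nodup) (hw : w <:+: l) :
    w.toFinset.card = w.length :=
  List.toFinset_card_of_nodup (h.sublist hw.sublist)

/-- Two disjoint `(k - 1)`-tuples are connected, through `U`, by a tight path of fixed length. -/
theorem exists_connecting_path (k : ℕ) (hk : 2 ≤ k) (γ : ℝ) (hγ : 0 < γ) : ∃ L u₀ : ℕ,
    ∀ {V : Type} [DecidableEq V] (E : Finset V → Prop) (W U : Finset V),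
    Good k E (1 / 2 + γ) W U → U ⊆ W → u₀ ≤ U.card →
    ∀ x y : List V, (∀ v ∈ x, v ∈ W ∧ v ∉ U) → (∀ v ∈ y, v ∈ W ∧ v ∉ U) →
    (x ++ y).Nodup → x.length = k - 1 → y.length = k - 1 →
    ∃ m : List V, m.Nodup ∧ (∀ v ∈ m, v ∈ U) ∧ m.length = L ∧ Tight k E (x ++ m ++ y) := by
  obtain ⟨r, rfl⟩ : ∃ r, k = r + 1 := ⟨k - 1, by omega⟩
  simp only [Nat.add_sub_cancel]
  set t := r + (r + r * r) + r with ht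
  obtain ⟨u₀, hu₀⟩ := exists_blowup (2 * r) t (by omega) hγ
  refine ⟨r + r * r, u₀ + ⌈(2 * r : ℝ) / γ⌉₊, ?_⟩
  intro V _ E W U hG hUW hU x y hx hy hxy hxr hyr
  have hU2 : (2 * r : ℝ) ≤ γ * U.card := by
    have h1 : (2 * r : ℝ) / γ ≤ U.card := (Nat.le_ceil _).trans (Nat.cast_le.2 (by omega))
    rw [div_le_iff₀ hγ] at h1; linarith
  have hxn := (List.nodup_append.1 hxy).1
  have hyn := (List.nodup_append.1 hxy).2.1
  obtain ⟨φ, hφU, hφi, hφ⟩ := hu₀ U (fun l => l.Nodup ∧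
    Tight (r + 1) E (l.drop (l.length - r) ++ y) ∧
    Tight (r + 1) E (x ++ (l.take (l.length - r)).reverse) ∧
    Tight (r + 1) E (l.drop (l.length - r) ++ (l.take (l.length - r)).reverse)) (by omega)
    ⟨by simp, by simpa using tight_of_length_lt (by omega),
      by simpa using tight_of_length_lt (by omega), by simpa using tight_of_length_lt (by simp)⟩
    (by
      rintro l ⟨hl, h1, h2, h3⟩ hlU hlf
      rcases lt_or_ge l.length r with hlr | hlr
      · -- extending the tuple in front of `y`
        have e : l.length - r = 0 := by omega
        simp only [e, List.drop_zero, List.take_zero, List.reverse_nil, List.append_nil] at h1 h2 h3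
        have hly : (l ++ y).Nodup := List.nodup_append.2 ⟨hl, hyn, fun a ha b hb hab =>
          (hy b hb).2 (hab ▸ hlU a ha)⟩
        set s := (l ++ y).take r with hs
        have hsr : s.length = r := by simp [hs]; omega
        have hsW : s.toFinset ⊆ W := by
          intro v hv
          have := List.mem_of_mem_take (List.mem_toFinset.1 hv)
          rcases List.mem_append.1 this with h | h
          · exact hUW (hlU v h)
          · exact (hy v h).1
        have hsc : s.toFinset.card = r := by
          rw [card_toFinset_of_infix hly (List.take_prefix _ _).isInfix, hsr]
        have := hG.le_card_filter hsW hsW (by simpa) (by simpa) l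
        refine le_trans ?_ (this.trans (Nat.cast_le.2 (Finset.card_le_card ?_)))
        · have : (l.length : ℝ) ≤ 2 * r := by exact_mod_cast hlf.le
          linarith
        · intro v hv
          simp only [Finset.mem_filter] at hv ⊢
          obtain ⟨hvU, hvl, hvE, -⟩ := hv
          have e' : l.length + 1 - r = 0 := by omega
          simp only [List.length_cons, e', List.drop_zero, List.take_zero, List.reverse_nil,
            List.append_nil, List.nodup_cons]
          have := h1.cons (v := v) (List.take_prefix r _) (by rw [← hs, hsr]) hvE
          exact ⟨hvU, ⟨hvl, hl⟩, this, h2, Tight.left this⟩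
      · -- extending the tuple behind `x`
        have hdrop : ∀ v : V, (v :: l).drop (l.length + 1 - r) = l.drop (l.length - r) := by
          intro v
          rw [show l.length + 1 - r = (l.length - r) + 1 by omega, List.drop_succ_cons]
        have htake : ∀ v : V, ((v :: l).take (l.length + 1 - r)).reverse =
            (l.take (l.length - r)).reverse ++ [v] := by
          intro v
          rw [show l.length + 1 - r = (l.length - r) + 1 by omega, List.take_succ_cons,
            List.reverse_cons]
        set p := l.drop (l.length - r) with hp
        set z := (l.take (l.length - r)).reverse with hz
        have hpr : p.length = r := by simp [hp]; omega
        have hpl : ∀ v ∈ p, v ∈ l := fun v hv => List.mem_of_mem_drop hv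
        have hzl : ∀ v ∈ z, v ∈ l := fun v hv => List.mem_of_mem_take (List.mem_reverse.1 hv)
        have hzn : z.Nodup := List.nodup_reverse.2 (hl.sublist (List.take_sublist _ _))
        have hxz : (x ++ z).Nodup := List.nodup_append.2 ⟨hxn, hzn, fun a ha b hb hab =>
          (hx a ha).2 (hab ▸ hlU b (hzl b hb))⟩
        have hpz : (p ++ z).Nodup := by
          have := List.nodup_append_comm.1 ((List.take_append_drop (l.length - r) l).symm ▸ hl)
          refine (List.Perm.nodup_iff ?_).1 this
          exact List.Perm.append_left _ (List.reverse_perm _).symm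
        have key : ∀ q : List V, q.length = r → (q ++ z).Nodup → (∀ v ∈ q, v ∈ W) →
            ∃ s, s <:+ q ++ z ∧ s.length + 1 = r + 1 ∧ s.toFinset ⊆ W ∧ s.toFinset.card = r := by
          intro q hq hqz hqW
          refine ⟨(q ++ z).drop ((q ++ z).length - r), List.drop_suffix _ _, by simp; omega, ?_, ?_⟩
          · intro v hv
            have := List.mem_of_mem_drop (List.mem_toFinset.1 hv)
            rcases List.mem_append.1 this with h | h
            · exact hqW v h
            · exact hUW (hlU v (hzl v h))
          · rw [card_toFinset_of_infix hqz (List.drop_suffix _ _).isInfix]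
            simp; omega
        obtain ⟨s, hs1, hs2, hs3, hs4⟩ := key x hxr hxz (fun v hv => (hx v hv).1)
        obtain ⟨s', hs1', hs2', hs3', hs4'⟩ := key p hpr hpz (fun v hv => hUW (hlU v (hpl v hv)))
        have := hG.le_card_filter hs3 hs3' (by simpa) (by simpa) l
        refine le_trans ?_ (this.trans (Nat.cast_le.2 (Finset.card_le_card ?_)))
        · have : (l.length : ℝ) ≤ 2 * r := by exact_mod_cast hlf.le
          linarith
        · intro v hv
          simp only [Finset.mem_filter] at hv ⊢
          obtain ⟨hvU, hvl, hvE, hvE'⟩ := hv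
          simp only [List.length_cons, hdrop, htake, List.nodup_cons, ← List.append_assoc]
          exact ⟨hvU, ⟨hvl, hl⟩, h1, h2.concat hs1 hs2 hvE, h3.concat hs1' hs2' hvE'⟩)
  set I := List.finRange (2 * r) with hI
  have hIn : I.Nodup := List.nodup_finRange _
  have hIl : I.length = 2 * r := by simp [hI]
  set a : List (V ⊕ Fin (2 * r)) := (I.drop r).map Sum.inr with ha
  set s : List (V ⊕ Fin (2 * r)) := (I.take r).reverse.map Sum.inr with hs
  have hφ' : ∀ σ : Fin (2 * r) → ℕ, (∀ i, σ i < t) → ∀ g, g = Sum.elim id (fun i => φ i (σ i)) →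
      Tight (r + 1) E ((a ++ y.map Sum.inl).map g) ∧
      Tight (r + 1) E ((x.map Sum.inl ++ s).map g) ∧ Tight (r + 1) E ((a ++ s).map g) := by
    rintro σ hσ g rfl
    have := hφ σ hσ
    rw [List.ofFn_eq_map] at this
    have e : 2 * r - r = r := by omega
    simp only [List.length_map, ← hI, hIl, e] at this
    simpa [ha, hs, Function.comp_def] using this.2
  have hdisj : ∀ (z : List V) (J : List (Fin (2 * r))), z.Nodup → J.Nodup →
      (z.map Sum.inl ++ J.map Sum.inr).Nodup := by
    intro z J hz hJ
    refine List.nodup_append.2 ⟨hz.map Sum.inl_injective, hJ.map Sum.inr_injective, ?_⟩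
    simp
  have hdn : (I.drop r).Nodup := hIn.sublist (List.drop_sublist _ _)
  have htn : (I.take r).reverse.Nodup := List.nodup_reverse.2 (hIn.sublist (List.take_sublist _ _))
  have hasn : (a ++ s).Nodup := by
    rw [ha, hs, ← List.map_append]
    refine List.Nodup.map Sum.inr_injective ?_
    have := List.nodup_append_comm.1 ((List.take_append_drop r I).symm ▸ hIn)
    refine (List.Perm.nodup_iff ?_).1 this
    exact List.Perm.append_left _ (List.reverse_perm _).symm
  have T1 : Tight (r + 1) (LabelEdge (r + 1) t E φ) (a ++ y.map Sum.inl) :=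
    tight_labelEdge (List.nodup_append_comm.1 (hdisj _ _ hyn hdn))
      (fun σ hσ => (hφ' σ hσ _ rfl).1)
  have T2 : Tight (r + 1) (LabelEdge (r + 1) t E φ) (x.map Sum.inl ++ s) :=
    tight_labelEdge (hdisj _ _ hxn htn) (fun σ hσ => (hφ' σ hσ _ rfl).2.1)
  have T3 : Tight (r + 1) (LabelEdge (r + 1) t E φ) (a ++ s) :=
    tight_labelEdge hasn (fun σ hσ => (hφ' σ hσ _ rfl).2.2)
  have hsl : s.length = r := by simp [hs, hIl]; omega
  have hal : a.length = r := by simp [ha, hIl]; omega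
  obtain ⟨m, hm, hms, hmt, hsuf⟩ := exists_tight_return (by omega) T3
  rw [Nat.add_sub_cancel, List.take_left' hal] at hsuf
  obtain ⟨J, hJ⟩ := exists_map_inr (s ++ m) (by
    intro v hv
    have : v ∈ a ++ s := by
      rcases List.mem_append.1 hv with h | h
      · simp [h]
      · exact hms v h
    simp only [ha, hs, List.mem_append, List.mem_map] at this
    rcases this with ⟨i, -, h⟩ | ⟨i, -, h⟩ <;> exact ⟨i, h.symm⟩)
  have hJl : J.length = r + r * r := by
    have := congrArg List.length hJ
    simp [hm, hsl, hal] at this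
    omega
  have T4 : Tight (r + 1) (LabelEdge (r + 1) t E φ) (x.map Sum.inl ++ s ++ m) :=
    T2.append (by omega) hmt
  rw [List.append_assoc, hJ] at T4
  rw [hJ] at hsuf
  have T5 := T4.append_of_suffix (hsuf.trans (List.suffix_append _ _)) (by omega) T1
  have T6 := tight_realize (by omega) (by simp [hxr, hyr, hJl]; omega) T5
  rw [realize_sandwich] at T6
  refine ⟨_, nodup_copies (t := t) (by omega) hφi, fun v hv => ?_, by rw [length_copies, hJl], T6⟩
  obtain ⟨i, -, j, rfl⟩ := mem_copies hv
  exact hφU i j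

end

theorem Tight.append_append {V : Type} [DecidableEq V] {k : ℕ} {E : Finset V → Prop}
    {p q m s s' : List V} (hs : s <:+ p) (hs' : s' <+: q) (hk : k ≤ s.length + 1)
    (hk' : k ≤ s'.length + 1) (hp : Tight k E p) (hq : Tight k E q)
    (h : Tight k E (s ++ m ++ s')) : Tight k E (p ++ m ++ q) :=
  hq.append_of_prefix hs' hk' <| by
    rw [List.append_assoc]
    exact hp.append_of_suffix hs hk (by rwa [← List.append_assoc])

/-- Two disjoint tight paths are connected, through `U`, by a tight path of fixed length. -/
theorem exists_connection (k : ℕ) (hk : 2 ≤ k) (γ : ℝ) (hγ : 0 < γ) : ∃ L u₀ : ℕ,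
    ∀ {V : Type} [DecidableEq V] (E : Finset V → Prop) (W U : Finset V),
    Good k E (1 / 2 + γ) W U → U ⊆ W → u₀ ≤ U.card →
    ∀ p q : List V, (∀ v ∈ p, v ∈ W ∧ v ∉ U) → (∀ v ∈ q, v ∈ W ∧ v ∉ U) →
    (p ++ q).Nodup → k - 1 ≤ p.length → k - 1 ≤ q.length → Tight k E p → Tight k E q →
    ∃ m : List V, m.Nodup ∧ (∀ v ∈ m, v ∈ U) ∧ m.length = L ∧ Tight k E (p ++ m ++ q) := by
  obtain ⟨L, u₀, h⟩ := exists_connecting_path k hk γ hγ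
  refine ⟨L, u₀, fun E W U hG hUW hU p q hp hq hpq hpl hql htp htq => ?_⟩
  have hs := List.drop_suffix (p.length - (k - 1)) p
  have hs' := List.take_prefix (k - 1) q
  obtain ⟨m, hm, hmU, hml, hmt⟩ := h E W U hG hUW hU _ _ (fun v hv => hp v (hs.subset hv))
    (fun v hv => hq v (hs'.subset hv))
    (hpq.sublist (List.Sublist.append hs.sublist hs'.sublist)) (by simp; omega) (by simp; omega)
  exact ⟨m, hm, hmU, hml, htp.append_append hs hs' (by simp; omega) (by simp; omega) htq hmt⟩

/-- The `j` elements of smallest weight. -/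
theorem exists_lower_subset {V : Type} [DecidableEq V] (U : Finset V) (w : V → ℝ) {j : ℕ}
    (hj : j ≤ U.card) : ∃ Y ⊆ U, Y.card = j ∧ ∀ y ∈ Y, ∀ z ∈ U \ Y, w y ≤ w z := by
  induction j with
  | zero => exact ⟨∅, by simp, by simp, by simp⟩
  | succ j ih =>
    obtain ⟨Y, hYU, hYc, hY⟩ := ih (by omega)
    have hne : (U \ Y).Nonempty := by
      rw [← Finset.card_pos, Finset.card_sdiff_of_subset hYU]; omega
    obtain ⟨z, hz, hmin⟩ := Finset.exists_min_image _ w hne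
    obtain ⟨hzU, hzY⟩ := Finset.mem_sdiff.1 hz
    refine ⟨insert z Y, Finset.insert_subset hzU hYU, by simp [hzY, hYc], ?_⟩
    intro y hy z' hz'
    simp only [Finset.mem_sdiff, Finset.mem_insert, not_or] at hz'
    have hz'' : z' ∈ U \ Y := Finset.mem_sdiff.2 ⟨hz'.1, hz'.2.2⟩
    rcases Finset.mem_insert.1 hy with rfl | hy
    · exact hmin _ hz''
    · exact hY y hy z' hz''

theorem card_mul_le_sum_sdiff {V : Type} [DecidableEq V] {U Y Z : Finset V} {w : V → ℝ} {a : ℝ}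
    (hZ : Z ⊆ U \ Y) (h : ∀ z ∈ U \ Y, a ≤ w z) : Z.card * a ≤ ∑ v ∈ Z, w v := by
  have := Finset.card_nsmul_le_sum Z w a (fun z hz => h z (hZ hz))
  simpa using this

/-- There are nested sets `X ⊆ Y`, with `Y` half of `U` and `X` a small proportion of it, on which
the weights are bounded by thresholds `a` and `b` whose weighted mean is barely above the average
weight. -/
theorem exists_thresholds {V : Type} [DecidableEq V] (U : Finset V) (w : V → ℝ)
    (hw : ∀ v, 0 ≤ w v) {ε : ℝ} (hε : 0 < ε) (hε1 : ε ≤ 1 / 16) (hU : 2 / ε ≤ U.card) :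
    ∃ X Y : Finset V, ∃ a b : ℝ, X ⊆ Y ∧ Y ⊆ U ∧ ε * U.card ≤ X.card ∧
      (U.card : ℝ) / 2 ≤ Y.card ∧ (∀ v ∈ X, w v ≤ a) ∧ (∀ v ∈ Y, w v ≤ b) ∧ 0 ≤ a ∧ a ≤ b ∧
      (1 / 2 - 2 * ε) * U.card * (a + b) ≤ ∑ v ∈ U, w v := by
  rw [div_le_iff₀ hε] at hU
  set u : ℝ := (U.card : ℝ) with hu
  have hu0 : (0 : ℝ) ≤ u := Nat.cast_nonneg _
  obtain ⟨Y, hYU, hYc, hY⟩ := exists_lower_subset U w (j := (U.card + 1) / 2) (by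
    have : (0 : ℝ) < u := by nlinarith
    have : 0 < U.card := by rw [hu] at this; exact_mod_cast this
    omega)
  have hY1 : u ≤ 2 * Y.card := by
    have : U.card ≤ 2 * Y.card := by omega
    rw [hu]; exact_mod_cast this
  have hY2 : (2 * Y.card : ℝ) ≤ u + 1 := by
    have : 2 * Y.card ≤ U.card + 1 := by omega
    rw [hu]; exact_mod_cast this
  have hc := Nat.ceil_lt_add_one (a := ε * u) (by positivity)
  have hc' := Nat.le_ceil (ε * u)
  obtain ⟨X, hXY, hXc, hX⟩ := exists_lower_subset Y w (j := ⌈ε * u⌉₊) (by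
    have : (⌈ε * u⌉₊ : ℝ) ≤ Y.card := by nlinarith
    exact_mod_cast this)
  have hXne : X.Nonempty := by
    rw [← Finset.card_pos, hXc, Nat.ceil_pos]; linarith
  have hYne : Y.Nonempty := hXne.mono hXY
  obtain ⟨xa, hxa, hxam⟩ := Finset.exists_max_image X w hXne
  obtain ⟨yb, hyb, hybm⟩ := Finset.exists_max_image Y w hYne
  refine ⟨X, Y, w xa, w yb, hXY, hYU, by rw [hXc]; exact hc', by linarith, hxam, hybm, hw _,
    hybm _ (hXY hxa), ?_⟩
  have h1 := card_mul_le_sum_sdiff (Finset.Subset.refl _) (hY yb hyb)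
  have h2 := card_mul_le_sum_sdiff (Finset.Subset.refl _) (hX xa hxa)
  have h3 : 0 ≤ ∑ v ∈ X, w v := Finset.sum_nonneg fun v _ => hw v
  have h4 := Finset.sum_sdiff (f := w) hYU
  have h5 := Finset.sum_sdiff (f := w) hXY
  rw [Finset.card_sdiff_of_subset hYU, Nat.cast_sub (Finset.card_le_card hYU), ← hu] at h1
  rw [Finset.card_sdiff_of_subset hXY, Nat.cast_sub (Finset.card_le_card hXY), hXc] at h2
  have h6 : (1 / 2 - 2 * ε) * u ≤ u - Y.card := by nlinarith
  have h7 : (1 / 2 - 2 * ε) * u ≤ Y.card - ⌈ε * u⌉₊ := by nlinarith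
  have h8 := mul_le_mul_of_nonneg_right h6 (hw yb)
  have h9 := mul_le_mul_of_nonneg_right h7 (hw xa)
  linarith

theorem le_card_filter_of_forall {V : Type} [DecidableEq V] {U X : Finset V} {Q : V → Prop}
    {_ : DecidablePred Q} {l : List V} {c : ℝ} (h : ∀ v ∈ X, v ∉ l → v ∈ U ∧ Q v)
    (hc : c + l.length ≤ X.card) : c ≤ (U.filter Q).card := by
  have h1 : X ⊆ U.filter Q ∪ l.toFinset := by
    intro v hv
    by_cases hvl : v ∈ l
    · simp [hvl]
    · simp [h v hv hvl]
  have h2 := (Finset.card_le_card h1).trans (Finset.card_union_le _ _)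
  have h3 : X.card ≤ (U.filter Q).card + l.length := h2.trans (by have := l.toFinset_card_le; omega)
  have h4 : (X.card : ℝ) ≤ (U.filter Q).card + l.length := by exact_mod_cast h3
  linarith

/-- There are tight paths of any fixed length whose average weight is barely above the average
weight of the vertices. -/
theorem exists_light_path (k : ℕ) (hk : 2 ≤ k) (γ : ℝ) (hγ : 0 < γ) (δ : ℝ) (hδ : 0 < δ) (t : ℕ) :
    ∃ u₀ : ℕ, ∀ {V : Type} [DecidableEq V] (E : Finset V → Prop) (W U : Finset V),
    (∀ e, E e → e.card = k) → Good k E (1 / 2 + γ) W U → U ⊆ W → u₀ ≤ U.card → ∀ w : V → ℝ, (∀ v, 0 ≤ w v) →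
    ∃ p : List V, p.Nodup ∧ (∀ v ∈ p, v ∈ U) ∧ p.length = k * t ∧ Tight k E p ∧
      U.card * (p.map w).sum ≤ (1 + δ) * (k * t) * ∑ v ∈ U, w v := by
  obtain ⟨r, rfl⟩ : ∃ r, k = r + 1 := ⟨k - 1, by omega⟩
  set ε : ℝ := min δ 1 / 16 with hε
  have hε0 : 0 < ε := by positivity
  have hε1 : ε ≤ 1 / 16 := by rw [hε]; gcongr; exact min_le_right _ _
  have hεδ : 16 * ε ≤ δ := by rw [hε]; linarith [min_le_left δ 1]
  set T := (r + 1) * t + 1 with hT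
  obtain ⟨u₀, hu₀⟩ := exists_blowup (r + 1) T (by omega) (c := min (ε / 2) γ) (by positivity)
  refine ⟨u₀ + ⌈2 * (r + 1) / ε⌉₊, ?_⟩
  intro V _ E W U hE hG hUW hU w hw
  have hU2 : 2 * (r + 1) / ε ≤ U.card := (Nat.le_ceil _).trans (Nat.cast_le.2 (by omega))
  have hr1 : (1 : ℝ) ≤ r := by exact_mod_cast (by omega : 1 ≤ r)
  have hu : (0 : ℝ) < U.card := lt_of_lt_of_le (by positivity) hU2
  obtain ⟨X, Y, a, b, hXY, hYU, hXc, hYc, hXa, hYb, ha, hab, hsum⟩ :=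
    exists_thresholds U w hw hε0 hε1 (le_trans (by gcongr; linarith) hU2)
  rw [div_le_iff₀ hε0] at hU2
  obtain ⟨φ, hφU, hφi, hφ⟩ := hu₀ U (fun l => l.Nodup ∧ (∀ v ∈ l, v ∈ Y) ∧
    (∀ v ∈ l.drop (l.length - r), v ∈ X) ∧ (l.length = r + 1 → E l.toFinset)) (by omega)
    (by simp) (by
      rintro l ⟨hl, h1, h2, h3⟩ hlU hlf
      rcases lt_or_ge l.length r with hlr | hlr
      · refine le_card_filter_of_forall (X := X) (l := l) (fun v hv hvl => ?_) ?_
        · have e : l.length + 1 - r = 0 := by omega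
          have e' : l.length - r = 0 := by omega
          rw [e', List.drop_zero] at h2
          simp only [List.length_cons, e, List.drop_zero, List.nodup_cons, List.forall_mem_cons]
          exact ⟨hYU (hXY hv), ⟨hvl, hl⟩, ⟨hXY hv, h1⟩, ⟨hv, h2⟩, fun h => by omega⟩
        · have h6 : (l.length : ℝ) ≤ r + 1 := by exact_mod_cast hlf.le
          have h7 : min (ε / 2) γ * U.card ≤ ε / 2 * U.card := by gcongr; exact min_le_left _ _
          linarith
      · have hlr : l.length = r := by omega
        have e' : l.length - r = 0 := by omega
        rw [e', List.drop_zero] at h2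
        have hlc : l.toFinset.card = r := by rw [List.toFinset_card_of_nodup hl, hlr]
        have hdeg := hG l.toFinset (fun v hv => hUW (hYU (h1 v (List.mem_toFinset.1 hv)))) hlc
        refine le_card_filter_of_forall (X := nbr E l.toFinset U ∩ Y) (l := []) (fun v hv _ => ?_) ?_
        · obtain ⟨hv, hvY⟩ := Finset.mem_inter.1 hv
          obtain ⟨hvU, hvE⟩ := Finset.mem_filter.1 hv
          have hvl : v ∉ l := fun hvl => by
            have := hE _ hvE
            rw [Finset.insert_eq_of_mem (List.mem_toFinset.2 hvl)] at this
            omega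
          have e : l.length + 1 - r = 1 := by omega
          simp only [List.length_cons, e, List.drop_one, List.tail_cons, List.nodup_cons,
            List.forall_mem_cons]
          exact ⟨hvU, ⟨hvl, hl⟩, ⟨hvY, h1⟩, h2, fun _ => by simpa using hvE⟩
        · have h6 := Finset.card_union_add_card_inter (nbr E l.toFinset U) Y
          have h7 : (nbr E l.toFinset U ∪ Y).card ≤ U.card :=
            Finset.card_le_card (Finset.union_subset (Finset.filter_subset _ _) hYU)
          have h8 : ((nbr E l.toFinset U).card : ℝ) + Y.card ≤
              U.card + (nbr E l.toFinset U ∩ Y).card := by exact_mod_cast (by omega)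
          have h9 : min (ε / 2) γ * U.card ≤ γ * U.card := by gcongr; exact min_le_right _ _
          simp only [List.length_nil, Nat.cast_zero, add_zero]
          linarith)
  set g : Fin (r + 1) → ℝ := Fin.cons b (fun _ => a) with hg
  have hφg : ∀ i j, j < T → w (φ i j) ≤ g i := by
    intro i j hj
    obtain ⟨-, h1, h2, -⟩ := hφ (fun _ => j) (fun _ => hj)
    refine Fin.cases ?_ (fun i => ?_) i
    · exact hYb _ (h1 _ (by simp))
    · refine hXa _ (h2 _ ?_)
      simp [List.ofFn_succ]
  set C : List (Fin (r + 1)) := List.finRange (r + 1) with hC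
  have hCn : (C.map (Sum.inr : _ → V ⊕ Fin (r + 1))).Nodup :=
    (List.nodup_finRange _).map Sum.inr_injective
  set I := (List.replicate t C).flatten with hI
  have hIl : I.length = (r + 1) * t := by simp [hI, hC, mul_comm]
  have T1 : Tight (r + 1) (LabelEdge (r + 1) T E φ) (I.map Sum.inr) := by
    have := tight_flatten_replicate (k := r + 1) (E := LabelEdge (r + 1) T E φ)
      (C := C.map Sum.inr) (by simp [hC]) ⟨by
        rw [List.toFinset_card_of_nodup hCn]; simp [hC], fun σ hσ => by
        have := (hφ σ hσ).2.2.2 (by simp)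
        convert this using 1
        ext v
        simp [hC]
        rw [Fin.exists_fin_succ, eq_comm (a := v)]⟩ t
    rwa [hI, List.map_flatten, List.map_replicate]
  have T2 := tight_realize (by omega) (by simp [hIl, hT]) T1
  have e := realize_sandwich (φ := φ) [] [] I
  simp only [List.map_nil, List.nil_append, List.append_nil, List.length_nil] at e
  rw [e] at T2
  refine ⟨copies φ 0 I, nodup_copies (t := T) (by omega) hφi, fun v hv => ?_,
    by rw [length_copies, hIl], T2, ?_⟩
  · obtain ⟨i, -, j, rfl⟩ := mem_copies hv
    exact hφU i j
  · have h1 := sum_copies_le (φ := φ) (p := 0) (I := I) (t := T) w g (by omega) hφg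
    have h2 : (I.map g).sum = t * (b + r * a) := by
      rw [hI, List.map_flatten, List.sum_flatten, List.map_map]
      simp [hC, hg, ← List.ofFn_eq_map]
      ring
    rw [h2] at h1
    have hb : 0 ≤ b := ha.trans hab
    have h3 : b + r * a ≤ (r + 1) / 2 * (a + b) := by nlinarith
    have h4 : (1 : ℝ) ≤ (1 + δ) * (1 - 4 * ε) := by nlinarith
    have h5 : (0 : ℝ) ≤ (r + 1) * t / 2 * (U.card * (a + b)) := by positivity
    push_cast
    calc (U.card : ℝ) * ((copies φ 0 I).map w).sum
        ≤ U.card * (t * ((r + 1) / 2 * (a + b))) := by gcongr; exact h1.trans (by gcongr)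
      _ = 1 * ((r + 1) * t / 2 * (U.card * (a + b))) := by ring
      _ ≤ (1 + δ) * (1 - 4 * ε) * ((r + 1) * t / 2 * (U.card * (a + b))) := by gcongr
      _ = (1 + δ) * ((r + 1) * t) * ((1 / 2 - 2 * ε) * U.card * (a + b)) := by ring
      _ ≤ _ := by gcongr

/-- The segment `s` stays tight when `v` is inserted in its middle. -/
def Absorbs {V : Type} [DecidableEq V] (k : ℕ) (E : Finset V → Prop) (s : List V) (v : V) : Prop :=
  s.length = 2 * (k - 1) ∧ Tight k E (s.take (k - 1) ++ v :: s.drop (k - 1))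

section

variable {V : Type} [DecidableEq V] {k : ℕ} {E : Finset V → Prop}

theorem Absorbs.tight_insert {s X Y : List V} {v : V} (h : Absorbs k E s v)
    (ht : Tight k E (X ++ s ++ Y)) :
    Tight k E (X ++ (s.take (k - 1) ++ v :: s.drop (k - 1)) ++ Y) := by
  obtain ⟨hs, hv⟩ := h
  have hl : (s.take (k - 1)).length = k - 1 := by simp; omega
  have hr : (s.drop (k - 1)).length = k - 1 := by simp; omega
  have h1 : Tight k E (X ++ s.take (k - 1)) := by
    refine ht.of_infix ⟨[], s.drop (k - 1) ++ Y, ?_⟩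
    simp only [List.nil_append, List.append_assoc]
    rw [← List.append_assoc (s.take _), List.take_append_drop]
  have h2 : Tight k E (s.drop (k - 1) ++ Y) := by
    refine ht.of_infix ⟨X ++ s.take (k - 1), [], ?_⟩
    simp only [List.append_nil, List.append_assoc]
    rw [← List.append_assoc (s.take _), List.take_append_drop]
  have h3 := Tight.append (by omega) h1 hv
  refine h3.append_of_suffix (s := s.drop (k - 1)) ?_ (by omega) h2 |>.of_infix ?_
  · exact ⟨X ++ s.take (k - 1) ++ [v], by simp⟩
  · simp

/-- A path whose segments can absorb a list of vertices many times over can absorb all of it. -/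
theorem exists_absorption (L : List V) : ∀ (segs : List (List V)) (X Y : List V),
    Tight k E (X ++ segs.flatten ++ Y) →
    (∀ v ∈ L, L.length ≤ segs.countP (fun s => Absorbs k E s v)) →
    ∃ P, Tight k E (X ++ P ++ Y) ∧ P.Perm (segs.flatten ++ L) := by
  induction L with
  | nil => exact fun segs X Y h _ => ⟨segs.flatten, h, by simp⟩
  | cons v L ih =>
    intro segs X Y h hc
    have hpos : 0 < segs.countP (fun s => Absorbs k E s v) :=
      lt_of_lt_of_le (by simp) (hc v (by simp))
    obtain ⟨s, hs, hsv⟩ := List.countP_pos_iff.1 hpos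
    rw [decide_eq_true_eq] at hsv
    obtain ⟨A, B, rfl⟩ := List.append_of_mem hs
    have ht : Tight k E (X ++ (A ++ (s.take (k - 1) ++ v :: s.drop (k - 1)) :: B).flatten ++ Y) := by
      have := hsv.tight_insert (X := X ++ A.flatten) (Y := B.flatten ++ Y) (by simpa using h)
      simpa using this
    obtain ⟨P, hP, hperm⟩ := ih _ X Y ht (by
      intro w hw
      have := hc w (by simp [hw])
      rw [List.length_cons, List.countP_append, List.countP_cons] at this
      rw [List.countP_append, List.countP_cons]
      split_ifs at this ⊢ <;> omega)
    refine ⟨P, hP, hperm.trans ?_⟩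
    rw [List.perm_iff_count]
    intro a
    have := congrArg (List.count a) (List.take_append_drop (k - 1) s)
    simp only [List.count_append] at this
    simp only [List.flatten_append, List.flatten_cons, List.count_append, List.count_cons]
    omega

theorem exists_insertion_extension {W : Finset V} {r : ℕ} (hr : 1 ≤ r) (hrW : r ≤ W.card)
    {v : V} (hv : v ∈ W) {l : List V} (hl : l.Nodup) (hvl : v ∉ l) (hlW : ∀ a ∈ l, a ∈ W)
    (h1 : Tight (r + 1) E l)
    (h2 : Tight (r + 1) E (l.take (l.length - r) ++ v :: l.drop (l.length - r))) :
    ∃ S T : Finset V, S ⊆ W ∧ T ⊆ W ∧ S.card = r ∧ T.card = r ∧ ∀ a, E (insert a S) →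
      E (insert a T) → Tight (r + 1) E (a :: l) ∧
      Tight (r + 1) E ((a :: l).take ((a :: l).length - r) ++ v ::
        (a :: l).drop ((a :: l).length - r)) := by
  rcases lt_or_ge (l.length + 1) r with hlr | hlr
  · obtain ⟨S, -, hSW, hSr⟩ := Finset.exists_subsuperset_card_eq (Finset.empty_subset W)
      (Nat.zero_le _) hrW
    refine ⟨S, S, hSW, hSW, hSr, hSr, fun a _ _ => ⟨tight_of_length_lt (by simp; omega),
      tight_of_length_lt (by simp; omega)⟩⟩
  have hvlW : ∀ a ∈ v :: l, a ∈ W := by simpa using ⟨hv, hlW⟩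
  have hvln : (v :: l).Nodup := List.nodup_cons.2 ⟨hvl, hl⟩
  rcases hlr.eq_or_lt with hlr | hlr
  · have hS : (v :: l).toFinset ⊆ W := fun a ha => hvlW a (List.mem_toFinset.1 ha)
    have hSc : (v :: l).toFinset.card = r := by
      rw [List.toFinset_card_of_nodup hvln, List.length_cons, hlr]
    refine ⟨_, _, hS, hS, hSc, hSc, fun a ha _ => ⟨tight_of_length_lt (by simp; omega), ?_⟩⟩
    have e : (a :: l).length - r = 0 := by simp; omega
    rw [e]
    refine tight_of_length_eq (by simp; omega) ?_
    convert ha using 1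
    ext x
    simp
    tauto
  · set Q := l.take (l.length - r) ++ v :: l.drop (l.length - r) with hQ
    have hperm : Q.Perm (v :: l) := by
      refine List.perm_middle.trans ?_
      rw [List.take_append_drop]
    have sub : ∀ q : List V, r ≤ q.length → q.Nodup → (∀ a ∈ q, a ∈ W) →
        (q.take r).toFinset ⊆ W ∧ (q.take r).toFinset.card = r := by
      intro q hq hqn hqW
      refine ⟨fun a ha => hqW a (List.mem_of_mem_take (List.mem_toFinset.1 ha)), ?_⟩
      rw [card_toFinset_of_infix hqn (List.take_prefix _ _).isInfix, List.length_take]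
      omega
    have hQl : Q.length = l.length + 1 := hperm.length_eq
    obtain ⟨s1, s2⟩ := sub l (by omega) hl hlW
    obtain ⟨s3, s4⟩ := sub Q (by omega) (hperm.nodup_iff.2 hvln)
      (fun a ha => hvlW a (hperm.subset ha))
    refine ⟨_, _, s1, s3, s2, s4, fun a ha hav => ⟨h1.cons (List.take_prefix r _)
      (by simp; omega) ha, ?_⟩⟩
    have e : (a :: l).length - r = (l.length - r) + 1 := by simp; omega
    rw [e, List.take_succ_cons, List.drop_succ_cons, List.cons_append, ← hQ]
    exact h2.cons (List.take_prefix r _) (by simp; omega) hav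

/-- Every vertex has many absorbers. -/
theorem Good.pow_le_card_absorbers {W U : Finset V} {γ : ℝ} (hk : 2 ≤ k) (hγ : 0 < γ)
    (h : Good k E (1 / 2 + γ) W U) (hUW : U ⊆ W) (hU : k ≤ U.card) (hU2 : 2 * k ≤ γ * U.card)
    {v : V} (hv : v ∈ W) :
    (γ * U.card) ^ (2 * (k - 1)) ≤ (Finset.univ.filter (fun a : Fin (2 * (k - 1)) → U =>
      ((List.ofFn a).map Subtype.val).Nodup ∧ Tight k E ((List.ofFn a).map Subtype.val) ∧
      Absorbs k E ((List.ofFn a).map Subtype.val) v)).card := by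
  obtain ⟨r, rfl⟩ : ∃ r, k = r + 1 := ⟨k - 1, by omega⟩
  rw [Nat.add_sub_cancel]
  have := pow_le_card_seq (α := U) (c := γ * U.card) (fun l => (l.map Subtype.val).Nodup ∧
    v ∉ l.map Subtype.val ∧ Tight (r + 1) E (l.map Subtype.val) ∧
    Tight (r + 1) E ((l.map Subtype.val).take ((l.map Subtype.val).length - r) ++ v ::
      (l.map Subtype.val).drop ((l.map Subtype.val).length - r))) (by positivity) (2 * r)
    ⟨by simp, by simp, by simpa using tight_of_length_lt (by simp),
      by simpa using tight_of_length_lt (by simp; omega)⟩ (by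
      rintro l ⟨h1, h2, h3, h4⟩ hlf
      set q := l.map Subtype.val with hq
      have hqW : ∀ a ∈ q, a ∈ W := by
        intro a ha
        obtain ⟨b, -, rfl⟩ := List.mem_map.1 ha
        exact hUW b.2
      obtain ⟨S, T, hS, hT, hSc, hTc, hST⟩ := exists_insertion_extension (E := E) (by omega)
        (by have := Finset.card_le_card hUW; omega) hv h1 h2 hqW h3 h4
      have h5 := h.le_card_filter hS hT hSc hTc (v :: q)
      have h6 : ((v :: q).length : ℝ) ≤ 2 * (r + 1 : ℕ) := by
        have : (v :: q).length ≤ 2 * (r + 1) := by simp [hq]; omega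
        exact_mod_cast this
      refine le_trans (by linarith) (h5.trans (Nat.cast_le.2 ?_))
      refine Finset.card_le_card_of_surjOn Subtype.val ?_
      intro a ha
      simp only [Finset.coe_filter, Set.mem_ofPred_eq, List.mem_cons, not_or] at ha
      obtain ⟨haU, ⟨hav, haq⟩, haS, haT⟩ := ha
      refine ⟨⟨a, haU⟩, ?_, rfl⟩
      simp only [Finset.coe_filter, Set.mem_ofPred_eq, Finset.mem_univ, true_and, List.map_cons,
        List.nodup_cons, List.mem_cons, not_or]
      exact ⟨⟨haq, h1⟩, ⟨Ne.symm hav, h2⟩, hST a haS haT⟩)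
  refine this.trans (Nat.cast_le.2 (Finset.card_le_card fun a ha => ?_))
  simp only [Finset.mem_filter, Finset.mem_univ, true_and] at ha ⊢
  obtain ⟨h1, h2, h3, h4⟩ := ha
  refine ⟨h1, h3, by simp, ?_⟩
  have e : ((List.ofFn a).map Subtype.val).length - r = r := by simp; omega
  rw [e] at h4
  exact h4

/-- Some tight segment absorbs a fixed proportion of the total weight. -/
theorem Good.exists_absorber {W U : Finset V} {γ : ℝ} (hk : 2 ≤ k) (hγ : 0 < γ)
    (h : Good k E (1 / 2 + γ) W U) (hUW : U ⊆ W) (hU : k ≤ U.card) (hU2 : 2 * k ≤ γ * U.card)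
    (w : V → ℝ) (hw : ∀ v, 0 ≤ w v) (hpos : 0 < ∑ v ∈ W, w v) :
    ∃ s : List V, s.Nodup ∧ (∀ v ∈ s, v ∈ U) ∧ s.length = 2 * (k - 1) ∧ Tight k E s ∧
      γ ^ (2 * (k - 1)) * ∑ v ∈ W, w v ≤ ∑ v ∈ W, if Absorbs k E s v then w v else 0 := by
  set f := 2 * (k - 1) with hf
  set L : (Fin f → U) → List V := fun a => (List.ofFn a).map Subtype.val with hL
  set Q : (Fin f → U) → V → Prop := fun a v => (L a).Nodup ∧ Tight k E (L a) ∧ Absorbs k E (L a) v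
    with hQ
  have hUne : Nonempty U := by
    rw [Finset.nonempty_coe_sort, ← Finset.card_pos]; omega
  have hu : (0 : ℝ) < U.card := by
    have : 0 < U.card := by omega
    exact_mod_cast this
  have h1 : ∑ a : Fin f → U, γ ^ f * ∑ v ∈ W, w v ≤
      ∑ a : Fin f → U, ∑ v ∈ W, if Q a v then w v else 0 := by
    rw [Finset.sum_comm, Finset.sum_const, Finset.card_univ, nsmul_eq_mul, ← mul_assoc,
      Finset.mul_sum]
    refine Finset.sum_le_sum fun v hv => ?_
    have := h.pow_le_card_absorbers hk hγ hUW hU hU2 hv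
    rw [← Finset.sum_filter, Finset.sum_const, nsmul_eq_mul]
    refine mul_le_mul_of_nonneg_right (le_trans (le_of_eq ?_) this) (hw v)
    rw [mul_pow]
    simp
    ring
  obtain ⟨a, -, ha⟩ := Finset.exists_le_of_sum_le Finset.univ_nonempty h1
  have hgood : ∃ v ∈ W, Q a v := by
    by_contra hcon
    push Not at hcon
    rw [Finset.sum_eq_zero (fun v hv => if_neg (hcon v hv))] at ha
    have : 0 < γ ^ f * ∑ v ∈ W, w v := by positivity
    linarith
  obtain ⟨v, -, hn, ht, -⟩ := hgood
  refine ⟨L a, hn, ?_, by simp [hL], ht, ha.trans (Finset.sum_le_sum fun v _ => ?_)⟩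
  · intro v hv
    obtain ⟨b, -, rfl⟩ := List.mem_map.1 hv
    exact b.2
  · by_cases h : Absorbs k E (L a) v
    · rw [if_pos h]; split_ifs <;> simp [hw v]
    · rw [if_neg h, if_neg (fun hq => h hq.2.2)]

end

section

variable {V : Type} [DecidableEq V] {k : ℕ} {E : Finset V → Prop}

theorem Good.mono {W U : Finset V} {η η' : ℝ} (h : Good k E η W U) (hη : η' ≤ η) :
    Good k E η' W U :=
  fun S hS hSk => (by gcongr : η' * U.card ≤ η * U.card).trans (h S hS hSk)

/-- Deleting few vertices hardly affects the relative codegrees. -/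
theorem Good.of_sdiff {W A U : Finset V} {γ : ℝ} (h : Good k E (1 / 2 + γ) W A) (hγ : 0 < γ)
    {Z : Finset V} (hU : U = A \ Z) (hZ : (Z.card : ℝ) ≤ γ / 2 * A.card) :
    Good k E (1 / 2 + γ / 2) W U := by
  intro S hS hSk
  have h1 := h S hS hSk
  have h2 : nbr E S A ⊆ nbr E S U ∪ Z := by
    intro v hv
    obtain ⟨hvW, hvE⟩ := Finset.mem_filter.1 hv
    by_cases hvZ : v ∈ Z
    · simp [hvZ]
    · exact Finset.mem_union_left _ (Finset.mem_filter.2 ⟨by simp [hU, hvW, hvZ], hvE⟩)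
  have h3 : ((nbr E S A).card : ℝ) ≤ (nbr E S U).card + Z.card := by
    exact_mod_cast (Finset.card_le_card h2).trans (Finset.card_union_le _ _)
  have h4 : (U.card : ℝ) ≤ A.card := by
    rw [hU]; exact_mod_cast Finset.card_le_card Finset.sdiff_subset
  nlinarith

theorem card_sub_le_card_sdiff (W Z : Finset V) : (W.card : ℝ) - Z.card ≤ (W \ Z).card := by
  have := Finset.le_card_sdiff Z W
  have h : (W.card : ℝ) ≤ (W \ Z).card + Z.card := by exact_mod_cast (by omega)
  linarith

/-- A list of segments forming, after `x`, a tight path that avoids `y`. -/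
structure SegPath (k : ℕ) (E : Finset V → Prop) (W : Finset V) (x y : List V)
    (segs : List (List V)) : Prop where
  tight : Tight k E (x ++ segs.flatten)
  nodup : (x ++ segs.flatten ++ y).Nodup
  mem : ∀ v ∈ x ++ segs.flatten ++ y, v ∈ W

/-- One step of the greedy construction of the absorbing path. -/
theorem exists_absorbing_step (k : ℕ) (hk : 2 ≤ k) (γ : ℝ) (hγ : 0 < γ) (hγ1 : γ ≤ 1 / 2) :
    ∃ R n₀ : ℕ, 0 < R ∧ ∀ {V : Type} [DecidableEq V] (E : Finset V → Prop) (W : Finset V),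
    Good k E (1 / 2 + γ) W W → n₀ ≤ W.card →
    ∀ x y : List V, x.length = k - 1 → y.length = k - 1 → ∀ segs, SegPath k E W x y segs →
    segs.flatten.length ≤ γ / 4 * W.card →
    ∃ m s : List V, SegPath k E W x y (segs ++ [m, s]) ∧ m.length + s.length = R ∧
      (γ / 2) ^ (2 * (k - 1)) * ∑ v ∈ W, (1 / 2 : ℝ) ^ segs.countP (fun s => Absorbs k E s v) ≤
        ∑ v ∈ W, if Absorbs k E s v then
          (1 / 2 : ℝ) ^ segs.countP (fun s => Absorbs k E s v) else 0 := by
  obtain ⟨L, u₀, hcon⟩ := exists_connection k hk (γ / 2) (by positivity)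
  refine ⟨L + 2 * (k - 1), 2 * (u₀ + k) + ⌈(16 * k : ℝ) / γ⌉₊ + 1, by omega, ?_⟩
  intro V _ E W hG hW x y hx hy segs hseg hlen
  have hn : (16 * k : ℝ) ≤ γ * W.card := by
    have h1 : (16 * k : ℝ) / γ ≤ W.card := (Nat.le_ceil _).trans (Nat.cast_le.2 (by omega))
    rw [div_le_iff₀ hγ] at h1; linarith
  have hn2 : (2 * (u₀ + k) : ℝ) + 1 ≤ W.card := by
    have : 2 * (u₀ + k) + 1 ≤ W.card := by omega
    exact_mod_cast this
  have hk0 : (2 : ℝ) ≤ k := by exact_mod_cast hk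
  have hx' : (x.length : ℝ) ≤ k := by exact_mod_cast (by omega : x.length ≤ k)
  have hy' : (y.length : ℝ) ≤ k := by exact_mod_cast (by omega : y.length ≤ k)
  set Z := (x ++ segs.flatten ++ y).toFinset with hZ
  have hZc : (Z.card : ℝ) ≤ γ / 4 * W.card + 2 * k := by
    have : (Z.card : ℝ) ≤ x.length + segs.flatten.length + y.length := by
      exact_mod_cast (List.toFinset_card_le _).trans (by simp; omega)
    linarith
  have key := card_sub_le_card_sdiff W
  have hhalf : γ / 2 * W.card ≤ 1 / 4 * W.card :=
    mul_le_mul_of_nonneg_right (by linarith) (Nat.cast_nonneg _)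
  have hGU : Good k E (1 / 2 + γ / 2) W (W \ Z) := hG.of_sdiff hγ rfl (by linarith)
  have hUc : (k : ℝ) ≤ (W \ Z).card := by linarith [key Z]
  have hU2 : (2 * k : ℝ) ≤ γ / 2 * (W \ Z).card := by
    have : (W.card : ℝ) / 2 ≤ (W \ Z).card := by linarith [key Z]
    nlinarith
  obtain ⟨s, hsn, hsU, hsl, hst, hsum⟩ := hGU.exists_absorber hk (by positivity)
    Finset.sdiff_subset (by exact_mod_cast hUc) hU2
    (fun v => (1 / 2 : ℝ) ^ segs.countP (fun s => Absorbs k E s v)) (fun v => by positivity)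
    (Finset.sum_pos (fun v _ => by positivity) (by
      rw [← Finset.card_pos]; omega))
  set Z' := Z ∪ s.toFinset with hZ'
  have hZc' : (Z'.card : ℝ) ≤ γ / 4 * W.card + 4 * k := by
    have h1 : (s.length : ℝ) ≤ 2 * k := by exact_mod_cast (by omega : s.length ≤ 2 * k)
    have h2 : (Z'.card : ℝ) ≤ Z.card + s.length := by
      exact_mod_cast (Finset.card_union_le _ _).trans (by have := s.toFinset_card_le; omega)
    linarith
  have hGU' : Good k E (1 / 2 + γ / 2) W (W \ Z') := hG.of_sdiff hγ rfl (by linarith)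
  have hu₀ : (u₀ : ℝ) ≤ (W \ Z').card := by linarith [key Z']
  have hsZ : ∀ v ∈ s, v ∈ W ∧ v ∉ Z := fun v hv => by simpa using hsU v hv
  have hpn := hseg.nodup
  rw [List.nodup_append, List.nodup_append] at hpn
  obtain ⟨⟨hxn, hfn, hxf⟩, hyn, hxfy⟩ := hpn
  have hsn' : (x ++ segs.flatten ++ s).Nodup := List.nodup_append.2
    ⟨List.nodup_append.2 ⟨hxn, hfn, hxf⟩, hsn, fun a ha b hb hab => (hsZ b hb).2 (by
      rw [← hab, hZ, List.mem_toFinset, List.mem_append]; exact Or.inl ha)⟩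
  obtain ⟨m, hmn, hmU, hml, hmt⟩ := hcon E W (W \ Z') hGU' Finset.sdiff_subset
    (by exact_mod_cast hu₀) (x ++ segs.flatten) s
    (fun v hv => ⟨hseg.mem v (List.mem_append_left _ hv), by simp [hZ', hZ]; simp at hv; tauto⟩)
    (fun v hv => ⟨(hsZ v hv).1, by simp [hZ', hv]⟩) hsn' (by simp; omega) (by omega) hseg.tight hst
  have hmZ : ∀ v ∈ m, v ∈ W ∧ v ∉ Z ∧ v ∉ s := fun v hv => by simpa [hZ'] using hmU v hv
  refine ⟨m, s, ⟨by simpa using hmt, ?_, ?_⟩, by omega, hsum⟩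
  · have : ((m ++ s) ++ (x ++ segs.flatten ++ y)).Nodup := by
      refine List.nodup_append.2 ⟨List.nodup_append.2 ⟨hmn, hsn, fun a ha b hb hab =>
        (hmZ a ha).2.2 (hab ▸ hb)⟩, hseg.nodup, fun a ha b hb hab => ?_⟩
      subst hab
      rcases List.mem_append.1 ha with h | h
      · exact (hmZ a h).2.1 (List.mem_toFinset.2 hb)
      · exact (hsZ a h).2 (List.mem_toFinset.2 hb)
    refine (List.Perm.nodup_iff ?_).1 this
    rw [List.perm_iff_count]
    intro a
    simp
    omega
  · intro v hv
    simp only [List.flatten_append, List.flatten_cons, List.flatten_nil, List.append_nil,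
      List.mem_append] at hv
    have := hseg.mem v
    simp only [List.mem_append] at this
    have h1 := hmZ v
    have h2 := hsZ v
    tauto

/-- There is a tight path using few vertices in which each vertex has linearly many absorbers. -/
theorem exists_absorbing_path (k : ℕ) (hk : 2 ≤ k) (γ : ℝ) (hγ : 0 < γ) (hγ1 : γ ≤ 1 / 2) :
    ∃ β : ℝ, 0 < β ∧ ∃ n₀ : ℕ, ∀ {V : Type} [DecidableEq V] (E : Finset V → Prop) (W : Finset V),
    Good k E (1 / 2 + γ) W W → n₀ ≤ W.card →
    ∀ x y : List V, x.length = k - 1 → y.length = k - 1 → (x ++ y).Nodup →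
    (∀ v ∈ x ++ y, v ∈ W) → ∃ segs, SegPath k E W x y segs ∧
    segs.flatten.length ≤ γ / 4 * W.card ∧
    ∀ v ∈ W, β * W.card ≤ segs.countP (fun s => Absorbs k E s v) := by
  obtain ⟨R, n₀, hR, hstep⟩ := exists_absorbing_step k hk γ hγ hγ1
  set c : ℝ := (γ / 2) ^ (2 * (k - 1)) with hc
  have hc0 : 0 < c := by positivity
  have hc1 : c ≤ 1 := pow_le_one₀ (by positivity) (by linarith)
  have hR0 : (0 : ℝ) < R := by exact_mod_cast hR
  set β : ℝ := c * γ / (16 * R) with hβ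
  have hβ0 : 0 < β := by positivity
  obtain ⟨n₁, hn₁⟩ : ∃ n₁ : ℕ, ∀ n : ℕ, n₁ ≤ n → c / 2 + Real.log n ≤ β * n := by
    have h1 : ∀ᶠ n : ℕ in Filter.atTop, ‖Real.log n‖ ≤ β / 2 * ‖(n : ℝ)‖ :=
      (Real.isLittleO_log_id_atTop.comp_tendsto tendsto_natCast_atTop_atTop).def (by positivity)
    have h2 : ∀ᶠ n : ℕ in Filter.atTop, c / β ≤ (n : ℝ) :=
      tendsto_natCast_atTop_atTop.eventually_ge_atTop _
    obtain ⟨n₁, hn₁⟩ := Filter.eventually_atTop.1 (h1.and h2)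
    refine ⟨n₁, fun n hn => ?_⟩
    obtain ⟨h1, h2⟩ := hn₁ n hn
    rw [div_le_iff₀ hβ0] at h2
    have := (le_abs_self _).trans h1
    rw [Real.norm_natCast] at this
    linarith
  refine ⟨β, hβ0, n₀ + n₁ + 1, ?_⟩
  intro V _ E W hG hW x y hx hy hxy hxyW
  have hWpos : (0 : ℝ) < W.card := by exact_mod_cast (by omega : 0 < W.card)
  have main : ∀ j : ℕ, (j * R : ℝ) ≤ γ / 4 * W.card → ∃ segs, SegPath k E W x y segs ∧
      segs.flatten.length = j * R ∧
      ∑ v ∈ W, (1 / 2 : ℝ) ^ segs.countP (fun s => Absorbs k E s v) ≤ (1 - c / 2) ^ j * W.card := by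
    intro j
    induction j with
    | zero =>
      refine fun _ => ⟨[], ⟨?_, by simpa using hxy, by simpa using hxyW⟩, by simp, by simp⟩
      exact tight_of_length_lt (by simp; omega)
    | succ j ih =>
      intro hj
      push_cast at hj
      obtain ⟨segs, hseg, hlen, hsum⟩ := ih (by nlinarith)
      obtain ⟨m, s, hseg', hlen', hsum'⟩ := hstep E W hG (by omega) x y hx hy segs hseg
        (by rw [hlen]; push_cast; nlinarith)
      refine ⟨_, hseg', by simp [hlen]; rw [← hlen']; ring, ?_⟩
      calc ∑ v ∈ W, (1 / 2 : ℝ) ^ (segs ++ [m, s]).countP (fun s => Absorbs k E s v)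
          ≤ ∑ v ∈ W, ((1 / 2 : ℝ) ^ segs.countP (fun s => Absorbs k E s v) - 1 / 2 *
            if Absorbs k E s v then (1 / 2 : ℝ) ^ segs.countP (fun s => Absorbs k E s v)
              else 0) := by
            refine Finset.sum_le_sum fun v _ => ?_
            by_cases h : Absorbs k E s v
            · rw [if_pos h]
              have : segs.countP (fun s => Absorbs k E s v) + 1 ≤
                  (segs ++ [m, s]).countP (fun s => Absorbs k E s v) := by
                simp [List.countP_append, List.countP_cons, h]
              refine (pow_le_pow_of_le_one (by norm_num) (by norm_num) this).trans (le_of_eq ?_)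
              ring
            · rw [if_neg h, mul_zero, sub_zero]
              refine pow_le_pow_of_le_one (by norm_num) (by norm_num) ?_
              simp [List.countP_append]
        _ ≤ (1 - c / 2) * ((1 - c / 2) ^ j * W.card) := by
            rw [Finset.sum_sub_distrib, ← Finset.mul_sum]
            have : 0 ≤ 1 - c / 2 := by linarith
            nlinarith
        _ = _ := by ring
  set j := ⌊γ / 4 * W.card / R⌋₊ with hj
  have hj1 : (j : ℝ) ≤ γ / 4 * W.card / R := Nat.floor_le (by positivity)
  have hj2 : γ / 4 * W.card / R < j + 1 := Nat.lt_floor_add_one _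
  rw [le_div_iff₀ hR0] at hj1
  obtain ⟨segs, hseg, hlen, hsum⟩ := main j hj1
  refine ⟨segs, hseg, by rw [hlen]; push_cast; exact hj1, fun v hv => ?_⟩
  set N := segs.countP (fun s => Absorbs k E s v) with hN
  have h1 : (1 / 2 : ℝ) ^ N ≤ (1 - c / 2) ^ j * W.card :=
    (Finset.single_le_sum (f := fun v => (1 / 2 : ℝ) ^ segs.countP (fun s => Absorbs k E s v))
      (fun _ _ => by positivity) hv).trans hsum
  have h2 : (1 - c / 2) ^ j * W.card ≤ Real.exp (-(c / 2) * j + Real.log W.card) := by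
    rw [Real.exp_add, Real.exp_log hWpos, mul_comm _ (j : ℝ), Real.exp_nat_mul]
    gcongr
    · linarith
    · linarith [Real.add_one_le_exp (-(c / 2))]
  have h3 : Real.exp (-N : ℝ) ≤ (1 / 2 : ℝ) ^ N := by
    rw [← mul_neg_one, Real.exp_nat_mul]
    gcongr
    rw [Real.exp_neg, one_div]
    gcongr
    linarith [Real.add_one_le_exp 1]
  have h4 := Real.exp_le_exp.1 (h3.trans (h1.trans h2))
  have h5 := hn₁ W.card (by omega)
  have h6 : γ / 4 * W.card / R * (c / 2) = 2 * (β * W.card) := by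
    rw [hβ]; field_simp; ring
  nlinarith

end

section

variable {V : Type} [DecidableEq V] {k : ℕ} {E : Finset V → Prop}

theorem card_nbr_sdiff {S U D : Finset V} (h : D ⊆ U) :
    (nbr E S (U \ D)).card + (nbr E S D).card = (nbr E S U).card := by
  rw [← Finset.card_union_of_disjoint, nbr, nbr, ← Finset.filter_union,
    Finset.sdiff_union_of_subset h, nbr]
  exact Finset.disjoint_filter_filter Finset.sdiff_disjoint

/-- The exponential potential controlling the relative codegrees of the sets in `F` into `U`. -/
noncomputable def potential (E : Finset V → Prop) (F : Finset (Finset V)) (lam : ℝ)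
    (U : Finset V) : ℝ :=
  ∑ S ∈ F, Real.exp (-lam * ((nbr E S U).card / U.card))

/-- The weight of a vertex: the share of the potential carried by the sets it neighbours. -/
noncomputable def weight (E : Finset V → Prop) (F : Finset (Finset V)) (lam : ℝ)
    (U : Finset V) (v : V) : ℝ :=
  ∑ S ∈ F, if E (insert v S) then Real.exp (-lam * ((nbr E S U).card / U.card)) else 0

theorem weight_nonneg (F : Finset (Finset V)) (lam : ℝ) (U : Finset V) (v : V) :
    0 ≤ weight E F lam U v :=
  Finset.sum_nonneg fun S _ => by split_ifs <;> positivity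

theorem weight_le_potential (F : Finset (Finset V)) (lam : ℝ) (U : Finset V) (v : V) :
    weight E F lam U v ≤ potential E F lam U :=
  Finset.sum_le_sum fun S _ => by split_ifs <;> first | exact le_rfl | positivity

theorem sum_weight (F : Finset (Finset V)) (lam : ℝ) (U D : Finset V) :
    ∑ v ∈ D, weight E F lam U v =
      ∑ S ∈ F, (nbr E S D).card * Real.exp (-lam * ((nbr E S U).card / U.card)) := by
  simp only [weight]
  rw [Finset.sum_comm]
  refine Finset.sum_congr rfl fun S _ => ?_
  rw [← Finset.sum_filter, Finset.sum_const, nsmul_eq_mul]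
  rfl

theorem potential_sdiff_le {F : Finset (Finset V)} {lam : ℝ} (hlam : 0 ≤ lam) {U D : Finset V}
    (hD : D ⊆ U) (hDU : D.card < U.card) (hq : lam * D.card ≤ U.card - D.card) {a : ℝ}
    (ha : ∑ v ∈ D, weight E F lam U v ≤ a * potential E F lam U +
      D.card / U.card * ∑ v ∈ U, weight E F lam U v) :
    potential E F lam (U \ D) ≤ potential E F lam U *
      Real.exp (lam * a / (U.card - D.card) + (lam * D.card / (U.card - D.card)) ^ 2) := by
  rw [sum_weight, sum_weight] at ha
  set u : ℝ := (U.card : ℝ) with hu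
  set R : ℝ := (D.card : ℝ) with hR
  have hRu : 0 < u - R := by
    rw [hu, hR, sub_pos]; exact_mod_cast hDU
  have hR0 : 0 ≤ R := Nat.cast_nonneg _
  have hu0 : 0 < u := by linarith
  have hq1 : lam * R / (u - R) ≤ 1 := by rw [div_le_one hRu]; exact hq
  have hq0 : 0 ≤ lam * R / (u - R) := by positivity
  have hcard : ((U \ D).card : ℝ) = u - R := by
    rw [Finset.card_sdiff_of_subset hD, Nat.cast_sub (Finset.card_le_card hD)]
  set e : Finset V → ℝ := fun S => Real.exp (-lam * ((nbr E S U).card / u)) with he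
  have key : ∀ S, Real.exp (-lam * ((nbr E S (U \ D)).card / (U \ D).card)) ≤
      e S * (1 + (lam * R / (u - R)) ^ 2) + lam / (u - R) * ((nbr E S D).card * e S -
        R / u * ((nbr E S U).card * e S)) := by
    intro S
    have h1 : ((nbr E S (U \ D)).card : ℝ) = (nbr E S U).card - (nbr E S D).card := by
      have := card_nbr_sdiff (E := E) (S := S) hD
      rw [eq_sub_iff_add_eq]; exact_mod_cast this
    have h2 : ((nbr E S D).card : ℝ) ≤ R := Nat.cast_le.2 (Finset.card_filter_le _ _)
    have h3 : ((nbr E S U).card : ℝ) / u ≤ 1 := by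
      rw [div_le_one hu0]; exact Nat.cast_le.2 (Finset.card_filter_le _ _)
    have h4 : 0 ≤ ((nbr E S U).card : ℝ) / u := by positivity
    have h5 : (0 : ℝ) ≤ (nbr E S D).card := Nat.cast_nonneg _
    set N : ℝ := ((nbr E S U).card : ℝ)
    set r : ℝ := ((nbr E S D).card : ℝ)
    set z := lam / (u - R) * (r - N / u * R) with hz
    have h6 : |z| ≤ lam * R / (u - R) := by
      rw [hz, abs_mul, abs_of_nonneg (by positivity : 0 ≤ lam / (u - R)), mul_div_right_comm]
      gcongr
      rw [abs_le]
      constructor <;> nlinarith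
    have h7 : Real.exp z ≤ 1 + z + (lam * R / (u - R)) ^ 2 := by
      have h8 := (abs_le.1 (Real.abs_exp_sub_one_sub_id_le (h6.trans hq1))).2
      have h9 : z ^ 2 ≤ (lam * R / (u - R)) ^ 2 := by rw [← sq_abs z]; gcongr
      linarith
    have h8 : -lam * ((N - r) / (u - R)) = -lam * (N / u) + z := by
      rw [hz]; field_simp; ring
    rw [hcard, h1, h8, Real.exp_add]
    calc e S * Real.exp z ≤ e S * (1 + z + (lam * R / (u - R)) ^ 2) := by gcongr
      _ = _ := by rw [hz]; ring
  have hP : potential E F lam U = ∑ S ∈ F, e S := rfl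
  have hP0 : 0 ≤ potential E F lam U := Finset.sum_nonneg fun S _ => by positivity
  calc potential E F lam (U \ D) ≤ _ := Finset.sum_le_sum fun S _ => key S
    _ = potential E F lam U * (1 + (lam * R / (u - R)) ^ 2) + lam / (u - R) *
        (∑ S ∈ F, (nbr E S D).card * e S - R / u * ∑ S ∈ F, (nbr E S U).card * e S) := by
      rw [Finset.sum_add_distrib, ← Finset.sum_mul, ← Finset.mul_sum, Finset.sum_sub_distrib,
        Finset.mul_sum F _ (R / u), hP]
    _ ≤ potential E F lam U * (1 + (lam * R / (u - R)) ^ 2) + lam / (u - R) *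
        (a * potential E F lam U) := by
      gcongr
      linarith
    _ = potential E F lam U * (lam * a / (u - R) + (lam * R / (u - R)) ^ 2 + 1) := by ring
    _ ≤ _ := by
      gcongr
      exact Real.add_one_le_exp _

theorem Good.potential_le {W U : Finset V} {η lam : ℝ} (h : Good k E η W U) (hlam : 0 ≤ lam)
    (hU : 0 < U.card) (hk : 1 ≤ k) (hW : 1 ≤ W.card) :
    potential E (W.powersetCard (k - 1)) lam U ≤ Real.exp (k * Real.log W.card - lam * η) := by
  have hu : (0 : ℝ) < U.card := by exact_mod_cast hU
  have hW' : (1 : ℝ) ≤ W.card := by exact_mod_cast hW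
  have h1 : potential E (W.powersetCard (k - 1)) lam U ≤
      ∑ S ∈ W.powersetCard (k - 1), Real.exp (-(lam * η)) := by
    refine Finset.sum_le_sum fun S hS => ?_
    obtain ⟨hSW, hSk⟩ := Finset.mem_powersetCard.1 hS
    rw [Real.exp_le_exp, neg_mul, neg_le_neg_iff]
    gcongr
    rw [le_div_iff₀ hu]
    exact h S hSW hSk
  refine h1.trans ?_
  rw [Finset.sum_const, Finset.card_powersetCard, nsmul_eq_mul, sub_eq_add_neg, Real.exp_add,
    Real.exp_nat_mul, Real.exp_log (by linarith)]
  gcongr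
  calc ((W.card.choose (k - 1) : ℕ) : ℝ) ≤ (W.card : ℝ) ^ (k - 1) := by
        exact_mod_cast Nat.choose_le_pow _ _
    _ ≤ (W.card : ℝ) ^ k := pow_le_pow_right₀ hW' (by omega)

theorem good_of_potential_le {W U : Finset V} {η lam : ℝ} (hlam : 0 < lam)
    (hU : 0 < U.card)
    (h : potential E (W.powersetCard (k - 1)) lam U ≤ Real.exp (-(lam * η))) :
    Good k E η W U := by
  intro S hSW hSk
  have hu : (0 : ℝ) < U.card := by exact_mod_cast hU
  have h1 := (Finset.single_le_sum (f := fun S => Real.exp (-lam * ((nbr E S U).card / U.card)))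
    (fun _ _ => by positivity) (Finset.mem_powersetCard.2 ⟨hSW, hSk⟩)).trans h
  rw [Real.exp_le_exp, neg_mul, neg_le_neg_iff] at h1
  have h2 := le_of_mul_le_mul_left h1 hlam
  rwa [le_div_iff₀ hu] at h2

end

theorem exists_forall_log_le (a : ℝ) {b : ℝ} (hb : 0 < b) :
    ∃ n₀ : ℕ, ∀ n : ℕ, n₀ ≤ n → a * Real.log n ≤ b * n := by
  have h1 : ∀ᶠ n : ℕ in Filter.atTop, ‖a * Real.log n‖ ≤ b * ‖(n : ℝ)‖ :=
    ((Real.isLittleO_log_id_atTop.comp_tendsto tendsto_natCast_atTop_atTop).const_mul_left a).def hb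
  obtain ⟨n₀, h⟩ := Filter.eventually_atTop.1 h1
  refine ⟨n₀, fun n hn => ?_⟩
  have := (le_abs_self _).trans (h n hn)
  rwa [Real.norm_natCast] at this

/-- A tight path can be extended by a short path so that the potential of the set of uncovered
vertices hardly grows. -/
theorem exists_balanced_extension (k : ℕ) (hk : 2 ≤ k) (g : ℝ) (hg : 0 < g) (δ : ℝ) (hδ : 0 < δ) :
    ∃ L : ℕ, ∀ t : ℕ, 0 < t → ∃ u₀ : ℕ, ∀ {V : Type} [DecidableEq V] (E : Finset V → Prop)
    (W U : Finset V), (∀ e, E e → e.card = k) → Good k E (1 / 2 + g) W U → U ⊆ W → u₀ ≤ U.card →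
    ∀ P : List V, (∀ v ∈ P, v ∈ W ∧ v ∉ U) → P.Nodup → k - 1 ≤ P.length → Tight k E P →
    ∀ (F : Finset (Finset V)) (lam : ℝ), ∃ q : List V, q.Nodup ∧ (∀ v ∈ q, v ∈ U) ∧
      q.length = L + k * t ∧ Tight k E (P ++ q) ∧
      ∑ v ∈ q.toFinset, weight E F lam U v ≤ (L + δ * (k * t)) * potential E F lam U +
        q.toFinset.card / U.card * ∑ v ∈ U, weight E F lam U v := by
  obtain ⟨L, u₁, hcon⟩ := exists_connection k hk (g / 2) (by positivity)
  refine ⟨L, fun t ht => ?_⟩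
  obtain ⟨u₂, hlight⟩ := exists_light_path k hk g hg δ hδ t
  refine ⟨u₁ + u₂ + k * t + ⌈2 * (k * t) / g⌉₊ + 1, ?_⟩
  intro V _ E W U hE hG hUW hU P hP hPn hPk hPt F lam
  obtain ⟨p, hpn, hpU, hpl, hpt, hpw⟩ :=
    hlight E W U hE hG hUW (by omega) (weight E F lam U) (weight_nonneg F lam U)
  have hUg : 2 * (k * t) / g ≤ U.card := (Nat.le_ceil _).trans (Nat.cast_le.2 (by omega))
  have hpc : p.toFinset.card = k * t := by rw [List.toFinset_card_of_nodup hpn, hpl]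
  have hG' : Good k E (1 / 2 + g / 2) W (U \ p.toFinset) := by
    refine hG.of_sdiff hg rfl ?_
    rw [hpc]
    rw [div_le_iff₀ hg] at hUg
    push_cast
    linarith
  have hU' : u₁ ≤ (U \ p.toFinset).card := by
    have := Finset.le_card_sdiff p.toFinset U
    omega
  have hkt : k ≤ k * t := Nat.le_mul_of_pos_right k ht
  obtain ⟨m, hmn, hmU, hml, hmt⟩ := hcon E W _ hG' (Finset.sdiff_subset.trans hUW) hU' P p
    (fun v hv => ⟨(hP v hv).1, fun h => (hP v hv).2 (Finset.mem_sdiff.1 h).1⟩)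
    (fun v hv => ⟨hUW (hpU v hv), fun h => (Finset.mem_sdiff.1 h).2 (by simpa using hv)⟩)
    (List.nodup_append'.2 ⟨hPn, hpn, fun v hv hv' => (hP v hv).2 (hpU v hv')⟩)
    hPk (by omega) hPt hpt
  have hmU' : ∀ v ∈ m, v ∈ U ∧ v ∉ p := fun v hv => by simpa using hmU v hv
  have hn : (m ++ p).Nodup :=
    List.nodup_append'.2 ⟨hmn, hpn, fun v hv hv' => (hmU' v hv).2 hv'⟩
  refine ⟨m ++ p, hn, ?_, by simp [hml, hpl], by simpa using hmt, ?_⟩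
  · intro v hv
    rcases List.mem_append.1 hv with h | h
    · exact (hmU' v h).1
    · exact hpU v h
  have hU0 : (0 : ℝ) < U.card := by
    have : 0 < U.card := by omega
    exact_mod_cast this
  rw [List.toFinset_card_of_nodup hn, List.sum_toFinset _ hn, List.map_append, List.sum_append]
  have h1 : (m.map (weight E F lam U)).sum ≤ L * potential E F lam U := by
    have := List.sum_le_card_nsmul (m.map (weight E F lam U)) (potential E F lam U) (by
      intro x hx
      obtain ⟨v, -, rfl⟩ := List.mem_map.1 hx
      exact weight_le_potential F lam U v)
    simpa [hml] using this
  have h2 : ∑ v ∈ U, weight E F lam U v ≤ U.card * potential E F lam U := by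
    have := Finset.sum_le_card_nsmul U _ _ fun v _ => weight_le_potential (E := E) F lam U v
    simpa using this
  have h0 : 0 ≤ ∑ v ∈ U, weight E F lam U v :=
    Finset.sum_nonneg fun v _ => weight_nonneg F lam U v
  set S := ∑ v ∈ U, weight E F lam U v
  have h3 : (p.map (weight E F lam U)).sum ≤ (1 + δ) * (k * t) * (S / U.card) := by
    rw [← mul_div_assoc, le_div_iff₀ hU0]
    linarith
  have h4 : S / U.card ≤ potential E F lam U := by
    rw [div_le_iff₀ hU0]; linarith
  have h5 : ((m ++ p).length : ℝ) / U.card * S = (L + k * t) * (S / U.card) := by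
    rw [List.length_append, hml, hpl]
    push_cast
    ring
  rw [h5]
  have h6 : 0 ≤ S / U.card := by positivity
  have h7 : δ * (k * t) * (S / U.card) ≤ δ * (k * t) * potential E F lam U := by gcongr
  have h8 : 0 ≤ L * (S / U.card) := by positivity
  linarith

theorem balance_estimate {g β η L T : ℝ} (hg : 0 < g) (hβ : 0 < β) (hη : 0 < η) (hL : 0 ≤ L)
    (hLT : 32 * L ≤ g * β * T) (hR : η * (L + T) = g * β ^ 2 / 32) :
    2 * η * (L + g * β / 32 * T) / β + (2 * η * (L + T) / β) ^ 2 ≤ η * g / 4 * (L + T) := by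
  have h3 : (2 * η * (L + T) / β) ^ 2 = η * g * (L + T) / 8 := by
    have : (2 * η * (L + T) / β) ^ 2 = 4 * (η * (L + T)) * (η * (L + T)) / β ^ 2 := by ring
    rw [this]
    nth_rw 2 [hR]
    field_simp
    ring
  have h4 : 2 * η * (L + g * β / 32 * T) / β ≤ η * g * (L + T) / 8 := by
    rw [div_le_iff₀ hβ]
    have h1 := mul_le_mul_of_nonneg_left hLT hη.le
    have h2 : 0 ≤ η * g * β * L := by positivity
    linarith
  linarith

/-- A tight path can be extended through a given vertex set until only a small part, to which all
relative codegrees are still above `1 / 2`, is left uncovered. -/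
theorem exists_path_cover (k : ℕ) (hk : 2 ≤ k) (g : ℝ) (hg : 0 < g) (hg1 : g ≤ 1 / 2) (β : ℝ)
    (hβ : 0 < β) (hβ1 : β ≤ 1) : ∃ n₀ : ℕ, ∀ {V : Type} [DecidableEq V] (E : Finset V → Prop)
    (W U : Finset V) (P : List V), (∀ e, E e → e.card = k) → n₀ ≤ W.card → U ⊆ W →
    Good k E (1 / 2 + g) W U → β / 2 * W.card ≤ U.card → (∀ v ∈ P, v ∈ W ∧ v ∉ U) → P.Nodup →
    k - 1 ≤ P.length → Tight k E P →
    ∃ (p : List V) (U' : Finset V), U' ⊆ U ∧ p.Nodup ∧ (∀ v, v ∈ p ↔ v ∈ U ∧ v ∉ U') ∧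
      Tight k E (P ++ p) ∧ Good k E (1 / 2 + g / 2) W U' ∧ β / 2 * W.card ≤ U'.card ∧
      U'.card ≤ β * W.card := by
  obtain ⟨L, hL⟩ := exists_balanced_extension k hk (g / 2) (by positivity) (g * β / 32)
    (by positivity)
  set t := ⌈32 * L / (g * β)⌉₊ + 1 with ht
  obtain ⟨u₀, hstep⟩ := hL t (by omega)
  set T := k * t with hT
  set R := L + T with hR
  have hT0 : 0 < T := by positivity
  have hLT : 32 * (L : ℝ) ≤ g * β * T := by
    have h1 : 32 * L / (g * β) ≤ (t : ℝ) := by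
      rw [ht]; push_cast; exact (Nat.le_ceil _).trans (by linarith)
    rw [div_le_iff₀ (by positivity)] at h1
    have h2 : (t : ℝ) ≤ T := by
      rw [hT]; exact_mod_cast Nat.le_mul_of_pos_left t (by omega)
    calc 32 * (L : ℝ) ≤ t * (g * β) := h1
      _ ≤ T * (g * β) := by gcongr
      _ = _ := by ring
  have hR0 : (0 : ℝ) < R := by rw [hR]; exact_mod_cast (by omega : 0 < L + T)
  have hRLT : (R : ℝ) = L + T := by rw [hR]; push_cast; ring
  set η : ℝ := g * β ^ 2 / (32 * R) with hη
  have hη0 : 0 < η := by positivity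
  have hηR : η * R = g * β ^ 2 / 32 := by rw [hη]; field_simp
  have hbal := balance_estimate hg hβ hη0 (Nat.cast_nonneg L) hLT (hRLT ▸ hηR)
  rw [← hRLT] at hbal
  have hηn : ∀ n : ℝ, 0 < n → η * n * R ≤ β / 2 * n := by
    intro n hn
    calc η * n * R = n * (η * R) := by ring
      _ = n * (g * β ^ 2 / 32) := by rw [hηR]
      _ ≤ n * (β / 2) := by
        refine mul_le_mul_of_nonneg_left ?_ hn.le
        have h1 : g * β ≤ 1 := mul_le_one₀ (by linarith) hβ.le hβ1
        have h2 : g * β ^ 2 ≤ 1 * β := by rw [pow_two, ← mul_assoc]; gcongr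
        linarith
      _ = _ := by ring
  clear_value η
  obtain ⟨n₁, hlog⟩ := exists_forall_log_le k (b := η * g / 4) (by positivity)
  refine ⟨n₁ + ⌈(u₀ + 2 * R) / β⌉₊ + 1, ?_⟩
  intro V _ E W U P hE hn hUW hG hU hP hPn hPk hPt
  have hlogn := hlog W.card (by omega)
  have hn1 : 1 ≤ W.card := by omega
  have hnβ : (u₀ + 2 * R : ℝ) ≤ W.card * β := by
    rw [← div_le_iff₀ hβ]
    exact (Nat.le_ceil _).trans (Nat.cast_le.2 (by omega))
  set n : ℝ := (W.card : ℝ) with hnn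
  have hn0 : 0 < n := by rw [hnn]; exact_mod_cast hn1
  set lam := η * n with hlam
  have hlam0 : 0 < lam := by positivity
  set F := W.powersetCard (k - 1) with hF
  set A := k * Real.log n - lam * (1 / 2 + g) with hA
  have key : ∀ (u : ℕ) (U : Finset V) (P : List V), U.card = u → U ⊆ W → β / 2 * n ≤ U.card →
      potential E F lam U ≤ Real.exp (A + η * g / 4 * (n - U.card)) →
      (∀ v ∈ P, v ∈ W ∧ v ∉ U) → P.Nodup → k - 1 ≤ P.length → Tight k E P →
      ∃ (p : List V) (U' : Finset V), U' ⊆ U ∧ p.Nodup ∧ (∀ v, v ∈ p ↔ v ∈ U ∧ v ∉ U') ∧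
      Tight k E (P ++ p) ∧ Good k E (1 / 2 + g / 2) W U' ∧ β / 2 * n ≤ U'.card ∧
      U'.card ≤ β * n := by
    intro u
    induction u using Nat.strong_induction_on with
    | _ u ih =>
    intro U P hu hUW hU hpot hP hPn hPk hPt
    have hU0 : (0 : ℝ) < U.card := lt_of_lt_of_le (by positivity) hU
    have hUc : 0 < U.card := by exact_mod_cast hU0
    have hG : Good k E (1 / 2 + g / 2) W U := by
      refine good_of_potential_le hlam0 hUc (hpot.trans (Real.exp_le_exp.2 ?_))
      have : η * g / 4 * (n - U.card) ≤ η * g / 4 * n := by gcongr; linarith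
      have h2 : lam * (1 / 2 + g) - lam * (1 / 2 + g / 2) = η * g / 4 * n + η * g / 4 * n := by
        rw [hlam]; ring
      linarith
    by_cases hUβ : (U.card : ℝ) ≤ β * n
    · exact ⟨[], U, subset_rfl, List.nodup_nil, by simp, by simpa using hPt, hG, hU, hUβ⟩
    push Not at hUβ
    obtain ⟨q, hqn, hqU, hql, hqt, hqw⟩ := hstep E W U hE hG hUW (by
      have : (u₀ : ℝ) ≤ U.card := by linarith
      exact_mod_cast this) P hP hPn hPk hPt F lam
    have hqc : q.toFinset.card = R := by rw [List.toFinset_card_of_nodup hqn, hql]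
    have hDU : q.toFinset ⊆ U := fun v hv => hqU v (by simpa using hv)
    have hRU : R < U.card := by
      have : (R : ℝ) < U.card := by linarith
      exact_mod_cast this
    have hcard : (U \ q.toFinset).card = U.card - R := by
      rw [Finset.card_sdiff_of_subset hDU, hqc]
    have hcard' : ((U \ q.toFinset).card : ℝ) = U.card - R := by
      rw [hcard, Nat.cast_sub hRU.le]
    have hUR : β / 2 * n ≤ U.card - R := by linarith
    have hpot' : potential E F lam (U \ q.toFinset) ≤
        Real.exp (A + η * g / 4 * (n - (U \ q.toFinset).card)) := by
      refine (potential_sdiff_le hlam0.le hDU (by rwa [hqc]) ?_ hqw).trans ?_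
      · rw [hqc]
        refine le_trans ?_ hUR
        exact hηn n hn0
      · refine (mul_le_mul_of_nonneg_right hpot (Real.exp_nonneg _)).trans ?_
        rw [← Real.exp_add, Real.exp_le_exp, hcard', hqc]
        have hd : ∀ x : ℝ, 0 ≤ x → lam * x / (U.card - R) ≤ 2 * η * x / β := by
          intro x hx
          calc lam * x / (U.card - R) ≤ lam * x / (β / 2 * n) := by gcongr
            _ = _ := by rw [hlam]; field_simp
        have h1 := hd (L + g * β / 32 * (k * t)) (by positivity)
        have h2 : (lam * R / (U.card - R)) ^ 2 ≤ (2 * η * R / β) ^ 2 := by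
          refine pow_le_pow_left₀ (div_nonneg (by positivity) ?_) (hd R hR0.le) 2
          exact le_trans (by positivity) hUR
        have hkt : ((k : ℝ) * t) = T := by rw [hT]; push_cast; ring
        rw [hkt] at h1 ⊢
        linarith
    obtain ⟨p, U', hU'U, hpn, hpm, hpt, hrest⟩ := ih (U \ q.toFinset).card (by omega)
      (U \ q.toFinset) (P ++ q) rfl (Finset.sdiff_subset.trans hUW) (by rw [hcard']; exact hUR)
      hpot' (by
        intro v hv
        rcases List.mem_append.1 hv with h | h
        · exact ⟨(hP v h).1, fun h' => (hP v h).2 (Finset.mem_sdiff.1 h').1⟩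
        · exact ⟨hUW (hqU v h), fun h' => (Finset.mem_sdiff.1 h').2 (by simpa using h)⟩)
      (List.nodup_append'.2 ⟨hPn, hqn, fun v hv hv' => (hP v hv).2 (hqU v hv')⟩)
      (by simp; omega) hqt
    refine ⟨q ++ p, U', hU'U.trans Finset.sdiff_subset, List.nodup_append'.2 ⟨hqn, hpn, ?_⟩, ?_,
      by simpa using hpt, hrest⟩
    · intro v hv hv'
      have := ((hpm v).1 hv').1
      simp [hv] at this
    · intro v
      rw [List.mem_append, hpm]
      constructor
      · rintro (h | h)
        · exact ⟨hqU v h, fun h' => by simpa [h] using hU'U h'⟩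
        · exact ⟨(Finset.mem_sdiff.1 h.1).1, h.2⟩
      · rintro ⟨h1, h2⟩
        by_cases hv : v ∈ q
        · exact Or.inl hv
        · exact Or.inr ⟨by simp [h1, hv], h2⟩
  have hU0 : (0 : ℝ) < U.card := lt_of_lt_of_le (by positivity) hU
  refine key U.card U P rfl hUW hU ?_ hP hPn hPk hPt
  refine (hG.potential_le hlam0.le (by exact_mod_cast hU0) (by omega) hn1).trans
    (Real.exp_le_exp.2 ?_)
  have h1 : (U.card : ℝ) ≤ n := by rw [hnn]; exact_mod_cast Finset.card_le_card hUW
  have h2 : 0 ≤ η * g / 4 * (n - U.card) := mul_nonneg (by positivity) (by linarith)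
  linarith

/-- Under the codegree condition any two disjoint sequences of `k - 1` vertices are the ends of a
spanning tight path. -/
theorem exists_spanning_path (k : ℕ) (hk : 2 ≤ k) (γ : ℝ) (hγ : 0 < γ) (hγ1 : γ ≤ 1 / 2) :
    ∃ n₀ : ℕ, ∀ {V : Type} [DecidableEq V] (E : Finset V → Prop) (W : Finset V),
    (∀ e, E e → e.card = k) → Good k E (1 / 2 + γ) W W → n₀ ≤ W.card →
    ∀ x y : List V, x.length = k - 1 → y.length = k - 1 → (x ++ y).Nodup →
    (∀ v ∈ x ++ y, v ∈ W) → ∃ l, Tight k E (x ++ l ++ y) ∧ (x ++ l ++ y).Nodup ∧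
      ∀ v, v ∈ x ++ l ++ y ↔ v ∈ W := by
  obtain ⟨β, hβ, n₁, habs⟩ := exists_absorbing_path k hk γ hγ hγ1
  obtain ⟨n₂, hcov⟩ := exists_path_cover k hk (γ / 2) (by positivity) (by linarith) (min β 1)
    (by positivity) (min_le_right _ _)
  obtain ⟨L, u₁, hcon⟩ := exists_connection k hk (γ / 2 / 2) (by positivity)
  set b := min β 1 with hb
  have hb0 : 0 < b := by positivity
  refine ⟨n₁ + n₂ + ⌈8 * k / γ⌉₊ + ⌈u₁ / (b / 2)⌉₊, ?_⟩
  intro V _ E W hE hG hn x y hx hy hxy hxyW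
  obtain ⟨segs, hS, hlen, hcount⟩ := habs E W hG (by omega) x y hx hy hxy hxyW
  have hn1 : 8 * k / γ ≤ W.card := (Nat.le_ceil _).trans (Nat.cast_le.2 (by omega))
  have hn2 : u₁ / (b / 2) ≤ W.card := (Nat.le_ceil _).trans (Nat.cast_le.2 (by omega))
  rw [div_le_iff₀ (by positivity)] at hn1 hn2
  have hn0 : (0 : ℝ) ≤ W.card := by positivity
  set A := x ++ segs.flatten ++ y with hA
  have hAc : (A.toFinset.card : ℝ) ≤ γ / 2 * W.card := by
    have h1 : A.toFinset.card ≤ segs.flatten.length + 2 * k := by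
      refine (List.toFinset_card_le _).trans ?_
      simp only [hA, List.length_append, hx, hy]
      omega
    have h2 : (A.toFinset.card : ℝ) ≤ segs.flatten.length + 2 * k := by exact_mod_cast h1
    linarith
  set U := W \ A.toFinset with hU
  have hUA : ∀ v, v ∈ U ↔ v ∈ W ∧ v ∉ A := fun v => by simp [hU]
  have hGU : Good k E (1 / 2 + γ / 2) W U := hG.of_sdiff hγ rfl hAc
  have hUc : b / 2 * W.card ≤ U.card := by
    have h1 := card_sub_le_card_sdiff W A.toFinset
    have h2 : b ≤ 1 := min_le_right _ _
    have h3 : b / 2 * W.card ≤ 1 / 2 * W.card := by gcongr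
    have h4 : γ / 2 * W.card ≤ 1 / 2 * W.card := by gcongr; linarith
    linarith
  have hAW : ∀ v ∈ A, v ∈ W := hS.mem
  have hPA : ∀ v ∈ x ++ segs.flatten, v ∈ A := fun v hv => List.mem_append_left _ hv
  obtain ⟨p, U', hU'U, hpn, hpm, hpt, hG', hU'1, hU'2⟩ := hcov E W U (x ++ segs.flatten) hE
    (by omega) Finset.sdiff_subset hGU hUc
    (fun v hv => ⟨hAW v (hPA v hv), fun h => ((hUA v).1 h).2 (hPA v hv)⟩)
    (hS.nodup.sublist (List.sublist_append_left _ _)) (by simp [hx]) hS.tight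
  have hU'W : U' ⊆ W := hU'U.trans Finset.sdiff_subset
  have hyA : ∀ v ∈ y, v ∈ A := fun v hv => List.mem_append_right _ hv
  have hAp : (A ++ p).Nodup := List.nodup_append'.2
    ⟨hS.nodup, hpn, fun v hv hv' => ((hUA v).1 ((hpm v).1 hv').1).2 hv⟩
  have hAU' : ∀ v ∈ A, v ∉ U' := fun v hv hv' => ((hUA v).1 (hU'U hv')).2 hv
  obtain ⟨m, hmn, hmU, hml, hmt⟩ := hcon E W U' hG' hU'W
    (by
      have : (u₁ : ℝ) ≤ U'.card := by linarith
      exact_mod_cast this) (x ++ segs.flatten ++ p) y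
    (by
      intro v hv
      rcases List.mem_append.1 hv with h | h
      · exact ⟨hAW v (hPA v h), hAU' v (hPA v h)⟩
      · exact ⟨((hUA v).1 ((hpm v).1 h).1).1, ((hpm v).1 h).2⟩)
    (fun v hv => ⟨hAW v (hyA v hv), hAU' v (hyA v hv)⟩)
    ((List.perm_append_comm.append_left (x ++ segs.flatten)).nodup_iff.1
      (by simpa [hA] using hAp) |> fun h => by simpa using h)
    (by simp [hx]) (by omega) hpt (tight_of_length_lt (by omega))
  set Q := (U' \ m.toFinset).toList with hQ
  have hQm : ∀ v, v ∈ Q ↔ v ∈ U' ∧ v ∉ m := fun v => by simp [hQ]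
  have hQl : Q.length ≤ U'.card := by
    rw [hQ, Finset.length_toList]
    exact Finset.card_le_card Finset.sdiff_subset
  obtain ⟨P, hPt, hP⟩ := exists_absorption Q segs x (p ++ m ++ y) (by simpa using hmt) (by
    intro v hv
    have h1 := hcount v (hU'W ((hQm v).1 hv).1)
    have h2 : b * W.card ≤ β * W.card := by gcongr; exact min_le_left _ _
    have h3 : (Q.length : ℝ) ≤ U'.card := by exact_mod_cast hQl
    have h4 : (Q.length : ℝ) ≤ segs.countP (fun s => Absorbs k E s v) := by linarith
    exact_mod_cast h4)
  have hperm : (x ++ (P ++ p ++ m) ++ y).Perm (A ++ p ++ (m ++ Q)) := by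
    rw [List.perm_iff_count] at hP ⊢
    intro v
    have := hP v
    simp only [hA, List.count_append] at this ⊢
    omega
  refine ⟨P ++ p ++ m, by simpa using hPt, hperm.nodup_iff.2 ?_, fun v => ?_⟩
  · refine List.nodup_append'.2 ⟨hAp, List.nodup_append'.2
      ⟨hmn, Finset.nodup_toList _, fun v hv hv' => ((hQm v).1 hv').2 hv⟩, fun v hv hv' => ?_⟩
    have hvU : v ∈ U' := by
      rcases List.mem_append.1 hv' with h | h
      · exact hmU v h
      · exact ((hQm v).1 h).1
    rcases List.mem_append.1 hv with h | h
    · exact hAU' v h hvU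
    · exact ((hpm v).1 h).2 hvU
  · rw [hperm.mem_iff, List.mem_append (s := A ++ p), List.mem_append (s := A), List.mem_append (s := m), hpm,
      hQm, hUA]
    constructor
    · rintro ((h | h) | (h | h))
      · exact hAW v h
      · exact h.1.1
      · exact hU'W (hmU v h)
      · exact hU'W h.1
    · tauto

section

variable {V : Type} [DecidableEq V]

theorem prod_ite_mem_const (A B : Finset V) (c : ℝ) :
    ∏ i ∈ A, (if i ∈ B then c else 1) = c ^ (A ∩ B).card := by
  rw [Finset.prod_ite, Finset.prod_const, Finset.prod_const_one, mul_one,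
    Finset.filter_mem_eq_inter]

/-- The exponential moment of the discrepancy of a random subset of `M` on `B`. -/
theorem sum_exp_discrepancy_le {M B : Finset V} (hB : B ⊆ M) (lam : ℝ) :
    ∑ A ∈ M.powerset, Real.exp (lam * (2 * (A ∩ B).card - B.card)) ≤
      2 ^ M.card * Real.exp (lam ^ 2 / 2 * B.card) := by
  have h1 : ∀ A ∈ M.powerset, Real.exp (lam * (2 * (A ∩ B).card - B.card)) =
      (∏ i ∈ A, if i ∈ B then Real.exp lam else 1) *
        ∏ i ∈ M \ A, if i ∈ B then Real.exp (-lam) else 1 := by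
    intro A hA
    rw [prod_ite_mem_const, prod_ite_mem_const, ← Real.exp_nat_mul, ← Real.exp_nat_mul,
      ← Real.exp_add]
    have h2 : ((A ∩ B).card : ℝ) + ((M \ A) ∩ B).card = B.card := by
      rw [← Nat.cast_add, ← Finset.card_union_of_disjoint, ← Finset.union_inter_distrib_right,
        Finset.union_sdiff_of_subset (Finset.mem_powerset.1 hA), Finset.inter_eq_right.2 hB]
      exact Finset.disjoint_sdiff.mono Finset.inter_subset_left Finset.inter_subset_left
    rw [← h2]
    ring_nf
  rw [Finset.sum_congr rfl h1, ← Finset.prod_add]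
  have h2 : ∀ i ∈ M, ((if i ∈ B then Real.exp lam else 1) + if i ∈ B then Real.exp (-lam) else 1) ≤
      2 * if i ∈ B then Real.exp (lam ^ 2 / 2) else 1 := by
    intro i _
    split_ifs
    · have := Real.cosh_le_exp_half_sq lam
      rw [Real.cosh_eq] at this
      linarith
    · norm_num
  refine (Finset.prod_le_prod (fun i _ => ?_) h2).trans ?_
  · split_ifs <;> positivity
  · rw [Finset.prod_mul_distrib, prod_ite_mem_const, Finset.prod_const, Finset.inter_eq_right.2 hB,
      ← Real.exp_nat_mul, mul_comm (B.card : ℝ)]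

theorem card_discrepancy_le {M B : Finset V} (hB : B ⊆ M) {m D : ℝ} (hm : M.card ≤ m) (hm0 : 0 < m)
    (hD : 0 ≤ D) : ((M.powerset.filter fun A => D < |2 * ((A ∩ B).card : ℝ) - B.card|).card : ℝ) ≤
      2 ^ M.card * (2 * Real.exp (-(D ^ 2 / (2 * m)))) := by
  set lam := D / m with hlam
  have hlam0 : 0 ≤ lam := by positivity
  have hBm : (B.card : ℝ) ≤ m := le_trans (by exact_mod_cast Finset.card_le_card hB) hm
  have h1 : ((M.powerset.filter fun A => D < |2 * ((A ∩ B).card : ℝ) - B.card|).card : ℝ) *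
      Real.exp (lam * D) ≤ ∑ A ∈ M.powerset, (Real.exp (lam * (2 * (A ∩ B).card - B.card)) +
        Real.exp (-lam * (2 * (A ∩ B).card - B.card))) := by
    rw [← nsmul_eq_mul]
    refine (Finset.card_nsmul_le_sum _ (fun A => Real.exp (lam * (2 * (A ∩ B).card - B.card)) +
        Real.exp (-lam * (2 * (A ∩ B).card - B.card))) _ ?_).trans
      (Finset.sum_le_sum_of_subset_of_nonneg (Finset.filter_subset _ _) fun _ _ _ => by positivity)
    intro A hA
    have hA := (Finset.mem_filter.1 hA).2
    rcases lt_abs.1 hA with h | h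
    · have : Real.exp (lam * D) ≤ Real.exp (lam * (2 * (A ∩ B).card - B.card)) := by gcongr
      linarith [Real.exp_nonneg (-lam * (2 * ((A ∩ B).card : ℝ) - B.card))]
    · have : Real.exp (lam * D) ≤ Real.exp (-lam * (2 * (A ∩ B).card - B.card)) := by
        rw [neg_mul, ← mul_neg]; gcongr
      linarith [Real.exp_nonneg (lam * (2 * ((A ∩ B).card : ℝ) - B.card))]
  rw [Finset.sum_add_distrib] at h1
  have h2 := sum_exp_discrepancy_le hB lam
  have h3 := sum_exp_discrepancy_le hB (-lam)
  rw [neg_sq] at h3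
  have h4 : Real.exp (lam ^ 2 / 2 * B.card) ≤
      Real.exp (-(D ^ 2 / (2 * m))) * Real.exp (lam * D) := by
    rw [← Real.exp_add, Real.exp_le_exp]
    calc lam ^ 2 / 2 * B.card ≤ lam ^ 2 / 2 * m := by gcongr
      _ = _ := by rw [hlam]; field_simp; ring
  refine le_of_mul_le_mul_right ?_ (Real.exp_pos (lam * D))
  have h5 : (2 : ℝ) ^ M.card * Real.exp (lam ^ 2 / 2 * B.card) ≤
      2 ^ M.card * (Real.exp (-(D ^ 2 / (2 * m))) * Real.exp (lam * D)) := by gcongr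
  linarith

/-- Most subsets of `M` split every member of a small family of sets evenly. -/
theorem card_balanced_ge {M : Finset V} (Bs : Finset (Finset V)) (hBs : ∀ B ∈ Bs, B ⊆ M) {m D : ℝ}
    (hm : M.card ≤ m) (hm0 : 0 < m) (hD : 0 ≤ D)
    (hsmall : Bs.card * (2 * Real.exp (-(D ^ 2 / (2 * m)))) ≤ 1 / 2) :
    2 ^ M.card * (1 / 2 : ℝ) ≤
      ((M.powerset.filter fun A => ∀ B ∈ Bs, |2 * ((A ∩ B).card : ℝ) - B.card| ≤ D).card : ℝ) := by
  have h1 : M.powerset ⊆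
      (M.powerset.filter fun A => ∀ B ∈ Bs, |2 * ((A ∩ B).card : ℝ) - B.card| ≤ D) ∪
      Bs.biUnion fun B => M.powerset.filter fun A => D < |2 * ((A ∩ B).card : ℝ) - B.card| := by
    intro A hA
    by_cases h : ∀ B ∈ Bs, |2 * ((A ∩ B).card : ℝ) - B.card| ≤ D
    · exact Finset.mem_union_left _ (Finset.mem_filter.2 ⟨hA, h⟩)
    · push Not at h
      obtain ⟨B, hB, h⟩ := h
      exact Finset.mem_union_right _ (Finset.mem_biUnion.2 ⟨B, hB, Finset.mem_filter.2 ⟨hA, h⟩⟩)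
  have h2 := (Finset.card_le_card h1).trans (Finset.card_union_le _ _)
  rw [Finset.card_powerset] at h2
  have h3 : ((Bs.biUnion fun B => M.powerset.filter fun A =>
      D < |2 * ((A ∩ B).card : ℝ) - B.card|).card : ℝ) ≤ 2 ^ M.card * (1 / 2) := by
    calc _ ≤ ((∑ B ∈ Bs, (M.powerset.filter fun A =>
            D < |2 * ((A ∩ B).card : ℝ) - B.card|).card : ℕ) : ℝ) := by
          exact_mod_cast Finset.card_biUnion_le
      _ ≤ ∑ B ∈ Bs, 2 ^ M.card * (2 * Real.exp (-(D ^ 2 / (2 * m)))) := by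
          rw [Nat.cast_sum]
          exact Finset.sum_le_sum fun B hB => card_discrepancy_le (hBs B hB) hm hm0 hD
      _ = 2 ^ M.card * (Bs.card * (2 * Real.exp (-(D ^ 2 / (2 * m))))) := by
          rw [Finset.sum_const, nsmul_eq_mul]; ring
      _ ≤ _ := by gcongr
  have h4 : (2 : ℝ) ^ M.card ≤ ((M.powerset.filter fun A => ∀ B ∈ Bs,
      |2 * ((A ∩ B).card : ℝ) - B.card| ≤ D).card : ℝ) + ((Bs.biUnion fun B =>
      M.powerset.filter fun A => D < |2 * ((A ∩ B).card : ℝ) - B.card|).card : ℝ) := by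
    exact_mod_cast h2
  linarith

end

section

variable {V : Type} [DecidableEq V] {k : ℕ} {E : Finset V → Prop}

/-- The tight paths with vertex set `W` that start with `x` and end with `y`. -/
noncomputable def hamPaths (k : ℕ) (E : Finset V → Prop) (W : Finset V) (x y : List V) :
    Finset (List V) :=
  W.val.lists.toFinset.filter fun l => Tight k E l ∧ x <+: l ∧ y <:+ l

theorem mem_hamPaths {W : Finset V} {x y l : List V} : l ∈ hamPaths k E W x y ↔
    l.Nodup ∧ l.toFinset = W ∧ Tight k E l ∧ x <+: l ∧ y <:+ l := by
  rw [hamPaths, Finset.mem_filter, Multiset.mem_toFinset, Multiset.mem_lists_iff,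
    ← and_assoc (a := l.Nodup)]
  refine and_congr_left fun _ => ⟨fun h => ?_, fun h => ?_⟩
  · have hl : l.Nodup := by
      have := W.nodup
      rw [h] at this
      exact this
    refine ⟨hl, Finset.val_injective ?_⟩
    rw [h, List.toFinset_val, hl.dedup]
    rfl
  · rw [← h.2, List.toFinset_val, h.1.dedup]
    rfl

/-- Tight paths of the two parts of a split vertex set can be concatenated. -/
theorem sum_card_hamPaths_le {W M : Finset V} {x y : List V} (hM : M = W \ (x ++ y).toFinset)
    (hW : ∀ v ∈ x ++ y, v ∈ W) (hxy : (x ++ y).Nodup) (As : Finset (Finset V))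
    (hAs : ∀ A ∈ As, A ⊆ M) (e f : Finset V → List V) (he : ∀ A ∈ As, k ≤ (e A).length + 1)
    (hf : ∀ A ∈ As, k ≤ (f A).length + 1) (hef : ∀ A ∈ As, Tight k E (e A ++ f A)) :
    ∑ A ∈ As, (hamPaths k E (A ∪ x.toFinset) x (e A)).card *
      (hamPaths k E ((M \ A) ∪ y.toFinset) (f A) y).card ≤
      (W.card + 1) * (hamPaths k E W x y).card := by
  have hMx : ∀ v ∈ M, v ∈ W ∧ v ∉ x ∧ v ∉ y := fun v hv => by
    rw [hM, Finset.mem_sdiff, List.mem_toFinset, List.mem_append, not_or] at hv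
    exact hv
  simp only [← Finset.card_product]
  rw [← Finset.card_sigma, ← Finset.card_range (W.card + 1), ← Finset.card_product]
  refine Finset.card_le_card_of_injOn (fun z => (z.2.1.length, z.2.1 ++ z.2.2)) ?_ ?_
  · rintro ⟨A, l, l'⟩ hz
    simp only [Finset.mem_coe, Finset.mem_sigma, Finset.mem_product, mem_hamPaths] at hz
    obtain ⟨hA, ⟨hn, hs, ht, hx, hx'⟩, hn', hs', ht', hy, hy'⟩ := hz
    have hl : ∀ v, v ∈ l ↔ v ∈ A ∨ v ∈ x := fun v => by
      rw [← List.mem_toFinset, hs, Finset.mem_union, List.mem_toFinset]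
    have hl' : ∀ v, v ∈ l' ↔ (v ∈ M ∧ v ∉ A) ∨ v ∈ y := fun v => by
      rw [← List.mem_toFinset, hs', Finset.mem_union, List.mem_toFinset, Finset.mem_sdiff]
    have hAM := hAs A hA
    have hx_y : ∀ v ∈ x, v ∉ y := fun v hv hv' => (List.nodup_append'.1 hxy).2.2 hv hv'
    have hnod : (l ++ l').Nodup := List.nodup_append'.2 ⟨hn, hn', fun v hv hv' => by
      rw [hl] at hv
      rw [hl'] at hv'
      rcases hv with h | h
      · rcases hv' with h' | h'
        · exact h'.2 h
        · exact (hMx v (hAM h)).2.2 h'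
      · rcases hv' with h' | h'
        · exact (hMx v h'.1).2.1 h
        · exact hx_y v h h'⟩
    have hset : (l ++ l').toFinset = W := by
      ext v
      rw [List.mem_toFinset, List.mem_append, hl, hl']
      constructor
      · rintro ((h | h) | (h | h))
        · exact (hMx v (hAM h)).1
        · exact hW v (by simp [h])
        · exact (hMx v h.1).1
        · exact hW v (by simp [h])
      · intro h
        by_cases hvx : v ∈ x
        · exact Or.inl (Or.inr hvx)
        by_cases hvy : v ∈ y
        · exact Or.inr (Or.inr hvy)
        by_cases hvA : v ∈ A
        · exact Or.inl (Or.inl hvA)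
        · exact Or.inr (Or.inl ⟨by rw [hM]; simp [h, hvx, hvy], hvA⟩)
    simp only [Finset.coe_product, Set.mem_prod, Finset.mem_coe, Finset.mem_range, mem_hamPaths]
    refine ⟨?_, hnod, hset, ?_, hx.trans (List.prefix_append _ _), hy'.trans
      (List.suffix_append _ _)⟩
    · have := List.toFinset_card_of_nodup hnod
      rw [hset, List.length_append] at this
      omega
    · have := ht.append_append (m := []) hx' hy (he A hA) (hf A hA) ht' (by simpa using hef A hA)
      simpa using this
  · rintro ⟨A, l, l'⟩ hz ⟨B, m, m'⟩ hz' heq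
    simp only [Finset.mem_coe, Finset.mem_sigma, Finset.mem_product, mem_hamPaths] at hz hz'
    simp only [Prod.mk.injEq] at heq
    obtain ⟨rfl, rfl⟩ := List.append_inj heq.2 heq.1
    have hdis : ∀ A ∈ As, (A ∪ x.toFinset) \ x.toFinset = A := by
      intro A hA
      rw [Finset.union_sdiff_right, Finset.sdiff_eq_self_iff_disjoint, Finset.disjoint_left]
      exact fun v hv hv' => (hMx v (hAs A hA hv)).2.1 (by simpa using hv')
    have : A = B := by
      rw [← hdis A hz.1, ← hz.2.1.2.1, hz'.2.1.2.1, hdis B hz'.1]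
    rw [this]

/-- Greedy extension of a tight path into a set with large codegrees. -/
theorem exists_tight_link (hk : 1 ≤ k) {W Y : Finset V} (hYW : Y ⊆ W)
    (hY : ∀ S ⊆ W, S.card = k - 1 → 2 * k ≤ (nbr E S Y).card) {e : List V}
    (he : e.length = k - 1) (hen : e.Nodup) (heW : ∀ v ∈ e, v ∈ W) (j : ℕ) (hj : j ≤ k) :
    ∃ f : List V, f.length = j ∧ (e ++ f).Nodup ∧ (∀ v ∈ f, v ∈ Y) ∧ Tight k E (e ++ f) := by
  induction j with
  | zero => exact ⟨[], rfl, by simpa using hen, by simp, tight_of_length_lt (by simp; omega)⟩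
  | succ j ih =>
    obtain ⟨f, hf, hn, hfY, ht⟩ := ih (by omega)
    have hs := List.drop_suffix ((e ++ f).length - (k - 1)) (e ++ f)
    set s := (e ++ f).drop ((e ++ f).length - (k - 1)) with hs_def
    have hsl : s.length = k - 1 := by
      rw [hs_def, List.length_drop, List.length_append]; omega
    have hsW : s.toFinset ⊆ W := fun v hv => by
      rcases List.mem_append.1 (hs.subset (List.mem_toFinset.1 hv)) with h | h
      · exact heW v h
      · exact hYW (hfY v h)
    have hc := hY s.toFinset hsW
      (by rw [List.toFinset_card_of_nodup (hn.sublist hs.sublist), hsl])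
    have hsk : s.length + 1 = k := by rw [hsl, Nat.sub_add_cancel hk]
    obtain ⟨v, hv, hv'⟩ := Finset.exists_mem_notMem_of_card_lt_card
      (s := (e ++ f).toFinset) (t := nbr E s.toFinset Y) (by
        refine lt_of_le_of_lt (List.toFinset_card_le _) ?_
        simp only [List.length_append]
        omega)
    obtain ⟨hvY, hvE⟩ := Finset.mem_filter.1 hv
    rw [List.mem_toFinset] at hv'
    refine ⟨f ++ [v], by simp [hf], ?_, ?_, ?_⟩
    · rw [← List.append_assoc]
      exact List.nodup_append'.2 ⟨hn, List.nodup_singleton v, by simpa using hv'⟩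
    · intro u hu
      rcases List.mem_append.1 hu with h | h
      · exact hfY u h
      · rw [List.mem_singleton.1 h]; exact hvY
    · rw [← List.append_assoc]
      exact ht.concat hs hsk hvE

theorem card_nbr_inter (S A M : Finset V) (hA : A ⊆ M) : nbr E S A = A ∩ nbr E S M := by
  ext v
  simp only [nbr, Finset.mem_filter, Finset.mem_inter]
  have := @hA v
  tauto

/-- One part of a balanced split inherits the codegree condition up to a small loss. -/
theorem Good.of_balanced {W W₀ M A : Finset V} {θ ε D : ℝ} (h : Good k E (1 / 2 + θ) W W)
    (hW₀ : W₀ ⊆ W) (hM : M ⊆ W) (hWM : W.card ≤ M.card + 2 * k) (hA : A ⊆ M) (hAW : A ⊆ W₀)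
    (hW₀A : W₀.card ≤ A.card + k) (hA' : |2 * (A.card : ℝ) - M.card| ≤ D)
    (hbal : ∀ S ⊆ W, S.card = k - 1 →
      |2 * ((A ∩ nbr E S M).card : ℝ) - (nbr E S M).card| ≤ D)
    (hθ : 1 / 2 + θ ≤ 1) (hε : 0 ≤ ε) (hεθ : ε ≤ 1 / 2 + θ) (hD : D + 2 * k ≤ ε / 2 * W.card) :
    Good k E (1 / 2 + (θ - ε)) W₀ W₀ ∧
      ∀ S ⊆ W, S.card = k - 1 → (1 / 2 + θ - ε / 2) / 2 * W.card ≤ (nbr E S A).card := by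
  have hWM' : (W.card : ℝ) ≤ M.card + 2 * k := by exact_mod_cast hWM
  have hMW' : (M.card : ℝ) ≤ W.card := by exact_mod_cast Finset.card_le_card hM
  have hW₀' : (W₀.card : ℝ) ≤ A.card + k := by exact_mod_cast hW₀A
  have h2 : ∀ S ⊆ W, S.card = k - 1 →
      (1 / 2 + θ - ε / 2) / 2 * W.card ≤ (nbr E S A).card := by
    intro S hS hSk
    have h1 := h S hS hSk
    have h3 := (abs_le.1 (hbal S hS hSk)).1
    rw [← card_nbr_inter S A M hA] at h3
    have h4 : (nbr E S W).card ≤ (nbr E S M).card + 2 * k := by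
      have h5 : nbr E S W ⊆ nbr E S M ∪ (W \ M) := by
        intro v hv
        have hv := Finset.mem_filter.1 hv
        by_cases hvM : v ∈ M
        · exact Finset.mem_union_left _ (Finset.mem_filter.2 ⟨hvM, hv.2⟩)
        · exact Finset.mem_union_right _ (Finset.mem_sdiff.2 ⟨hv.1, hvM⟩)
      have h6 := (Finset.card_le_card h5).trans (Finset.card_union_le _ _)
      rw [Finset.card_sdiff_of_subset hM] at h6
      omega
    have h4' : ((nbr E S W).card : ℝ) ≤ (nbr E S M).card + 2 * k := by exact_mod_cast h4
    linarith
  refine ⟨fun S hS hSk => ?_, h2⟩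
  have h1 := h2 S (hS.trans hW₀) hSk
  have h3 : (nbr E S A).card ≤ (nbr E S W₀).card :=
    Finset.card_le_card (Finset.filter_subset_filter _ hAW)
  have h3' : ((nbr E S A).card : ℝ) ≤ (nbr E S W₀).card := by exact_mod_cast h3
  have h4 := (abs_le.1 hA').2
  have h5 : (W₀.card : ℝ) ≤ W.card / 2 + ε / 4 * W.card := by linarith
  have h6 : (1 / 2 + (θ - ε)) * W₀.card ≤ (1 / 2 + (θ - ε)) * (W.card / 2 + ε / 4 * W.card) :=
    mul_le_mul_of_nonneg_left h5 (by linarith)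
  have h7 : (1 / 2 + (θ - ε)) * (ε / 4 * W.card) ≤ 1 * (ε / 4 * W.card) := by
    gcongr
    linarith
  linarith

end

theorem exists_forall_log_add_le_sqrt (a c : ℝ) {b : ℝ} (hb : 0 < b) :
    ∃ n₀ : ℕ, ∀ n : ℕ, n₀ ≤ n → a * Real.log n + c ≤ b * √n := by
  have h1 : ∀ᶠ n : ℕ in Filter.atTop, ‖a * Real.log n‖ ≤ b / 2 * ‖(n : ℝ) ^ (1 / 2 : ℝ)‖ :=
    (((isLittleO_log_rpow_atTop (by norm_num : (0 : ℝ) < 1 / 2)).comp_tendsto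
      tendsto_natCast_atTop_atTop).const_mul_left a).def (half_pos hb)
  have h2 : ∀ᶠ n : ℕ in Filter.atTop, c / (b / 2) ≤ √(n : ℝ) :=
    (Real.tendsto_sqrt_atTop.comp tendsto_natCast_atTop_atTop).eventually_ge_atTop _
  obtain ⟨n₀, h⟩ := Filter.eventually_atTop.1 (h1.and h2)
  refine ⟨n₀, fun n hn => ?_⟩
  obtain ⟨h3, h4⟩ := h n hn
  rw [← Real.sqrt_eq_rpow, Real.norm_of_nonneg (Real.sqrt_nonneg _)] at h3
  rw [div_le_iff₀ (by positivity)] at h4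
  linarith [(le_abs_self _).trans h3]

section

variable {V : Type} [DecidableEq V] {k : ℕ} {E : Finset V → Prop}

/-- Many subsets of `M` split `M` and all neighbourhoods in `M` evenly. -/
theorem exists_balanced_splits {W M : Finset V} (hk : 2 ≤ k) (hM : M ⊆ W) (hW : 2 ≤ W.card) {D : ℝ}
    (hD : 0 ≤ D) (hsmall : k * Real.log W.card + 2 ≤ D ^ 2 / (2 * W.card)) :
    ∃ As : Finset (Finset V), 2 ^ M.card * (1 / 2 : ℝ) ≤ As.card ∧ ∀ A ∈ As, A ⊆ M ∧
      ∀ B, B = A ∨ B = M \ A → |2 * (B.card : ℝ) - M.card| ≤ D ∧ ∀ S ⊆ W, S.card = k - 1 →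
        |2 * ((B ∩ nbr E S M).card : ℝ) - (nbr E S M).card| ≤ D := by
  set Bs := insert M ((W.powersetCard (k - 1)).image fun S => nbr E S M) with hBs
  have hBsM : ∀ B ∈ Bs, B ⊆ M := by
    intro B hB
    rcases Finset.mem_insert.1 hB with rfl | h
    · exact subset_rfl
    · obtain ⟨S, -, rfl⟩ := Finset.mem_image.1 h
      exact Finset.filter_subset _ _
  have hn : (2 : ℝ) ≤ W.card := by exact_mod_cast hW
  have hcard : (Bs.card : ℝ) ≤ Real.exp (k * Real.log W.card) := by
    rw [Real.exp_nat_mul, Real.exp_log (by linarith)]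
    have h1 : Bs.card ≤ W.card ^ (k - 1) + 1 := by
      refine (Finset.card_insert_le _ _).trans (Nat.succ_le_succ ?_)
      refine Finset.card_image_le.trans ?_
      rw [Finset.card_powersetCard]
      exact Nat.choose_le_pow _ _
    have h2 : W.card ^ (k - 1) + 1 ≤ W.card ^ k := by
      obtain ⟨r, rfl⟩ : ∃ r, k = r + 1 := ⟨k - 1, by omega⟩
      rw [Nat.add_sub_cancel, pow_succ]
      have : 1 ≤ W.card ^ r := Nat.one_le_pow _ _ (by omega)
      nlinarith
    exact_mod_cast h1.trans h2
  have hlarge := card_balanced_ge Bs hBsM (m := W.card) (D := D)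
    (by exact_mod_cast Finset.card_le_card hM) (by linarith) hD (by
      calc Bs.card * (2 * Real.exp (-(D ^ 2 / (2 * W.card))))
          ≤ Real.exp (k * Real.log W.card) *
            (2 * Real.exp (-(k * Real.log W.card + 2))) := by gcongr
        _ = 2 * Real.exp (-2) := by
          rw [mul_left_comm, ← Real.exp_add]; congr 2; ring
        _ ≤ 1 / 2 := by
          have h1 : (2 : ℝ) ≤ Real.exp 1 := by linarith [Real.add_one_le_exp (1 : ℝ)]
          have h2 : Real.exp (-2) = 1 / (Real.exp 1 * Real.exp 1) := by
            rw [← Real.exp_add, Real.exp_neg]; norm_num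
          rw [h2, mul_one_div, div_le_div_iff₀ (by positivity) (by norm_num)]
          nlinarith)
  refine ⟨_, hlarge, fun A hA => ?_⟩
  obtain ⟨hAM, hA⟩ := Finset.mem_filter.1 hA
  rw [Finset.mem_powerset] at hAM
  have hMs := hA M (Finset.mem_insert_self _ _)
  rw [Finset.inter_eq_left.2 hAM] at hMs
  have hS : ∀ S ⊆ W, S.card = k - 1 →
      |2 * ((A ∩ nbr E S M).card : ℝ) - (nbr E S M).card| ≤ D := fun S hS hSk =>
    hA _ (Finset.mem_insert_of_mem (Finset.mem_image_of_mem _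
      (Finset.mem_powersetCard.2 ⟨hS, hSk⟩)))
  refine ⟨hAM, ?_⟩
  rintro B (rfl | rfl)
  · exact ⟨hMs, hS⟩
  have hcompl : ∀ C ⊆ M, |2 * (((M \ A) ∩ C).card : ℝ) - C.card| =
      |2 * ((A ∩ C).card : ℝ) - C.card| := by
    intro C hC
    have h2 : ((A ∩ C).card : ℝ) + ((M \ A) ∩ C).card = C.card := by
      rw [← Nat.cast_add, ← Finset.card_union_of_disjoint, ← Finset.union_inter_distrib_right,
        Finset.union_sdiff_of_subset hAM, Finset.inter_eq_right.2 hC]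
      exact Finset.disjoint_sdiff.mono Finset.inter_subset_left Finset.inter_subset_left
    rw [← abs_neg, ← h2]
    congr 1
    ring
  refine ⟨?_, fun S hSW hSk => ?_⟩
  · have := hcompl M subset_rfl
    rw [Finset.inter_eq_left.2 hAM, Finset.inter_eq_left.2 Finset.sdiff_subset] at this
    rwa [this]
  · rw [hcompl (nbr E S M) (Finset.filter_subset _ _)]
    exact hS S hSW hSk

end

/-- Superadditivity behind the halving recursion. -/
theorem entropy_halving {a b L K : ℝ} (ha : 0 < a) (hb : 0 < b) (ha3 : a + b ≤ 3 * a)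
    (hb3 : a + b ≤ 3 * b) (hK : K ≤ 3 / 20 * √(a + b)) :
    (a + b) * Real.log (a + b) - (a + b) * Real.log 2 - L * (a + b) + √(a + b) + K ≤
      (a * Real.log a - L * a + √a) + (b * Real.log b - L * b + √b) := by
  set n := a + b with hn
  have hn0 : 0 < n := by positivity
  have h1 : ∀ x : ℝ, 0 < x → x - n / 2 ≤ x * (Real.log x - (Real.log n - Real.log 2)) := by
    intro x hx
    have h := Real.one_sub_inv_le_log_of_pos (x := x / (n / 2)) (by positivity)
    rw [Real.log_div hx.ne' (by positivity), Real.log_div hn0.ne' (by norm_num)] at h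
    calc x - n / 2 = x * (1 - (x / (n / 2))⁻¹) := by field_simp
      _ ≤ _ := by gcongr
  have h2 : ∀ x : ℝ, n ≤ 3 * x → 23 / 40 * √n ≤ √x := by
    intro x hx
    apply Real.le_sqrt_of_sq_le
    rw [mul_pow, Real.sq_sqrt hn0.le]
    linarith
  have h3 := h1 a ha
  have h4 := h1 b hb
  have h5 := h2 a ha3
  have h6 := h2 b hb3
  have h7 : n * Real.log n = a * Real.log n + b * Real.log n := by rw [hn]; ring
  have h8 : n * Real.log 2 = a * Real.log 2 + b * Real.log 2 := by rw [hn]; ring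
  have h9 : L * n = L * a + L * b := by rw [hn]; ring
  linarith

theorem inv_fourthRoot_le {s n : ℝ} (hs : 0 < s) (hsn : s ≤ 2 / 3 * n) :
    1 / √√n + 1 / 10 * (1 / √√n) ≤ 1 / √√s := by
  have hn : 0 < n := by linarith
  have h1 : √√s ≤ 10 / 11 * √√n := by
    apply Real.sqrt_le_iff.2 ⟨by positivity, ?_⟩
    rw [mul_pow, Real.sq_sqrt (Real.sqrt_nonneg n)]
    apply Real.sqrt_le_iff.2 ⟨by positivity, ?_⟩
    rw [mul_pow, Real.sq_sqrt hn.le]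
    linarith
  have h2 : 0 < √√s := by positivity
  calc _ = 1 / (10 / 11 * √√n) := by field_simp; norm_num
    _ ≤ _ := one_div_le_one_div_of_le h2 h1

/-- The lower bound for the logarithm of the number of tight paths spanning `s` vertices. -/
noncomputable def pathEntropy (L s : ℝ) : ℝ := s * Real.log s - L * s + √s

section

variable {V : Type} [DecidableEq V] {k : ℕ} {E : Finset V → Prop}

theorem card_half {W M A z : Finset V} {N k : ℕ} {n D : ℝ} (hn : (N : ℝ) = n)
    (hMW : M.card ≤ N) (hWM : N ≤ M.card + 2 * k)
    (hz : z.card ≤ k) (hW : W = A ∪ z) (hA : |2 * (A.card : ℝ) - M.card| ≤ D)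
    (hD : D + 2 * k ≤ n / 3) : N ≤ 3 * (W.card : ℝ) ∧ W.card ≤ 2 / 3 * n ∧ W.card ≤ A.card + k := by
  have h1 : W.card ≤ A.card + k := by
    rw [hW]; exact (Finset.card_union_le _ _).trans (by omega)
  have h2 : A.card ≤ W.card := by rw [hW]; exact Finset.card_le_card Finset.subset_union_left
  have h1' : (W.card : ℝ) ≤ A.card + k := by exact_mod_cast h1
  have h2' : (A.card : ℝ) ≤ W.card := by exact_mod_cast h2
  have h3 : (M.card : ℝ) ≤ N := by exact_mod_cast hMW
  have h4 : (N : ℝ) ≤ M.card + 2 * k := by exact_mod_cast hWM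
  obtain ⟨h5, h6⟩ := abs_le.1 hA
  have hk0 : (0 : ℝ) ≤ k := by positivity
  refine ⟨by linarith, by linarith, h1⟩

theorem exp_le_two_pow_mul_half {k m : ℕ} {n : ℝ} (h : n ≤ m + 2 * k) :
    Real.exp (n * Real.log 2 - (2 * k + 1)) ≤ (2 : ℝ) ^ m * (1 / 2) := by
  have h1 : (2 : ℝ) ^ m * (1 / 2) = Real.exp (m * Real.log 2 - Real.log 2) := by
    rw [Real.exp_sub, Real.exp_nat_mul, Real.exp_log (by norm_num)]; ring
  rw [h1, Real.exp_le_exp]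
  have h3 : Real.log 2 ≤ 1 := by linarith [Real.log_le_sub_one_of_pos (x := 2) (by norm_num)]
  have h4 : 0 ≤ Real.log 2 := Real.log_nonneg (by norm_num)
  have h5 : (0 : ℝ) ≤ k := Nat.cast_nonneg k
  have h6 := mul_le_mul_of_nonneg_right h h4
  have h7 := mul_le_mul_of_nonneg_left h3 h5
  linarith

theorem add_one_le_exp_log {k n : ℝ} (hn : 2 ≤ n) (hk : 1 ≤ k) :
    n + 1 ≤ Real.exp (k * Real.log n + 1) := by
  have h1 : 0 ≤ Real.log n := Real.log_nonneg (by linarith)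
  calc n + 1 ≤ n * 2 := by linarith
    _ ≤ Real.exp (Real.log n) * Real.exp 1 := by
      rw [Real.exp_log (by linarith)]
      gcongr
      linarith [Real.add_one_le_exp (1 : ℝ)]
    _ = Real.exp (Real.log n + 1) := (Real.exp_add _ _).symm
    _ ≤ _ := by
      gcongr
      nlinarith

set_option maxHeartbeats 800000 in
/-- The halving recursion for the number of spanning tight paths. -/
theorem exp_pathEntropy_le_card (hk : 2 ≤ k) {γ : ℝ} (hγ : 0 < γ) (hγ1 : γ ≤ 1 / 2) {L : ℝ}
    {W : Finset V} (hr : 80 * k + 4 ≤ √√(W.card : ℝ)) (hrγ : 2 / γ ≤ √√(W.card : ℝ))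
    (hlog : k * Real.log W.card + (2 * k + 2) ≤ 1 / 3200 * √(W.card : ℝ))
    (hG : Good k E (1 / 2 + (γ - 1 / √√(W.card : ℝ))) W W)
    (hrec : ∀ W' ⊆ W, W.card ≤ 3 * W'.card → W'.card < W.card →
      Good k E (1 / 2 + (γ - 1 / √√(W'.card : ℝ))) W' W' → ∀ x y : List V,
      x.length = k - 1 → y.length = k - 1 → (x ++ y).Nodup → (∀ v ∈ x ++ y, v ∈ W') →
      Real.exp (pathEntropy L W'.card) ≤ (hamPaths k E W' x y).card)
    {x y : List V} (hx : x.length = k - 1) (hy : y.length = k - 1) (hxy : (x ++ y).Nodup)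
    (hxyW : ∀ v ∈ x ++ y, v ∈ W) :
    Real.exp (pathEntropy L W.card) ≤ (hamPaths k E W x y).card := by
  set n : ℝ := (W.card : ℝ) with hn
  set r := √√n with hrdef
  have hk' : (2 : ℝ) ≤ k := by exact_mod_cast hk
  have hr0 : 0 < r := by linarith
  have hrr : r ^ 2 = √n := Real.sq_sqrt (Real.sqrt_nonneg n)
  have hn4 : r ^ 4 = n := by
    rw [show r ^ 4 = (r ^ 2) ^ 2 by ring, hrr, Real.sq_sqrt (by positivity)]
  have hr3 : (80 * k + 4) ≤ r ^ 3 := by nlinarith [sq_nonneg r, mul_pos hr0 hr0]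
  have hn0 : 0 < n := by rw [← hn4]; positivity
  set ε := 1 / 10 * (1 / r) with hε
  have hεr : ε * r = 1 / 10 := by rw [hε]; field_simp
  have hεn : ε * n = r ^ 3 / 10 := by rw [← hn4]; linear_combination r ^ 3 * hεr
  have hε0 : 0 < ε := by positivity
  set D := ε / 4 * n with hD
  have hD0 : 0 ≤ D := by positivity
  have hkr : 2 * k ≤ ε / 4 * n := by linarith
  have hDk : D + 2 * k ≤ ε / 2 * n := by linarith
  have hr1 : 1 / r ≤ γ := by
    rw [div_le_iff₀ hγ] at hrγ
    rw [div_le_iff₀ hr0]; linarith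
  have hε1 : ε ≤ 1 / 10 := by linarith
  have hDn : D + 2 * k ≤ n / 3 := hDk.trans (by nlinarith)
  set M := W \ (x ++ y).toFinset with hM
  have hMW : M ⊆ W := Finset.sdiff_subset
  have hMx : ∀ v ∈ M, v ∈ W ∧ v ∉ x ∧ v ∉ y := fun v hv => by
    rw [hM, Finset.mem_sdiff, List.mem_toFinset, List.mem_append, not_or] at hv
    exact hv
  have hWM' : W.card = M.card + (2 * k - 2) := by
    have h1 : (x ++ y).toFinset ⊆ W := fun v hv => hxyW v (List.mem_toFinset.1 hv)
    have h2 : (x ++ y).toFinset.card = 2 * k - 2 := by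
      rw [List.toFinset_card_of_nodup hxy, List.length_append]; omega
    rw [hM, Finset.card_sdiff_of_subset h1, h2]
    have := Finset.card_le_card h1
    omega
  have hWM : W.card ≤ M.card + 2 * k := by omega
  have hW2 : 2 ≤ W.card := by
    have : (2 : ℝ) ≤ W.card := by rw [← hn, ← hn4]; nlinarith
    exact_mod_cast this
  obtain ⟨As, hAsc, hAs⟩ := exists_balanced_splits (E := E) hk hMW hW2 hD0 (by
    have h1 : D ^ 2 / (2 * n) = 1 / 3200 * √n := by
      rw [div_eq_iff (by positivity), ← hrr, hD,
        show (ε / 4 * n) ^ 2 = (ε * n) ^ 2 / 16 by ring, hεn, ← hn4]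
      ring
    rw [← hn, h1]
    linarith)
  have hhalf : ∀ A ∈ As, ∀ B, B = A ∨ B = M \ A → ∀ z W' : Finset V, z.card ≤ k → W' = B ∪ z →
      z ⊆ W → W' ⊆ W ∧ W.card ≤ 3 * W'.card ∧ W'.card < W.card ∧
      Good k E (1 / 2 + (γ - 1 / √√(W'.card : ℝ))) W' W' ∧
      ∀ S ⊆ W, S.card = k - 1 → 2 * k ≤ (nbr E S B).card := by
    intro A hA B hB z W' hz hW' hzW
    obtain ⟨hAM, hAB⟩ := hAs A hA
    obtain ⟨hB1, hB2⟩ := hAB B hB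
    have hBM : B ⊆ M := by
      rcases hB with rfl | rfl
      · exact hAM
      · exact Finset.sdiff_subset
    have hW'W : W' ⊆ W := by rw [hW']; exact Finset.union_subset (hBM.trans hMW) hzW
    obtain ⟨h1, h2, h3⟩ := card_half hn.symm (Finset.card_le_card hMW) hWM hz hW' hB1 hDn
    have h4 : W.card ≤ 3 * W'.card := by exact_mod_cast h1
    have hW'0 : (0 : ℝ) < W'.card := by rw [← hn] at h1; linarith
    obtain ⟨h5, h6⟩ := hG.of_balanced hW'W hMW hWM hBM (by rw [hW']; exact Finset.subset_union_left)
      h3 hB1 hB2 (ε := ε) (by linarith) hε0.le (by linarith) (by rw [← hn]; exact hDk)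
    refine ⟨hW'W, h4, ?_, h5.mono ?_, fun S hS hSk => ?_⟩
    · have : (W'.card : ℝ) < W.card := by rw [← hn]; linarith
      exact_mod_cast this
    · have := inv_fourthRoot_le hW'0 h2
      rw [← hrdef] at this
      linarith
    · have h7 := h6 S hS hSk
      rw [← hn] at h7
      have h8 : (2 * k : ℝ) ≤ (nbr E S B).card := by
        refine le_trans ?_ h7
        have : ε / 4 * n ≤ (1 / 2 + (γ - 1 / r) - ε / 2) / 2 * n :=
          mul_le_mul_of_nonneg_right (by linarith) hn0.le
        linarith
      exact_mod_cast h8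
  have hxc : x.toFinset.card ≤ k := (List.toFinset_card_le x).trans (by omega)
  have hyc : y.toFinset.card ≤ k := (List.toFinset_card_le y).trans (by omega)
  have hxW : x.toFinset ⊆ W := fun v hv => hxyW v (by simp at hv; simp [hv])
  have hyW : y.toFinset ⊆ W := fun v hv => hxyW v (by simp at hv; simp [hv])
  have hlink : ∀ A ∈ As, ∃ e f : List V, e.length = k - 1 ∧ f.length = k - 1 ∧ e.Nodup ∧ f.Nodup ∧
      (∀ v ∈ e, v ∈ A) ∧ (∀ v ∈ f, v ∈ M \ A) ∧ Tight k E (e ++ f) := by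
    intro A hA
    obtain ⟨h1, h2, -, -, -⟩ := hhalf A hA A (Or.inl rfl) x.toFinset _ hxc rfl hxW
    obtain ⟨-, -, -, -, h3⟩ := hhalf A hA _ (Or.inr rfl) y.toFinset _ hyc rfl hyW
    have hAM := (hAs A hA).1
    have hAc : k - 1 ≤ A.card := by
      have h4 := Finset.card_union_le A x.toFinset
      have h5 : (8 * k : ℝ) ≤ W.card := by rw [← hn]; nlinarith
      have h6 : 8 * k ≤ W.card := by exact_mod_cast h5
      omega
    obtain ⟨e, heA, hec⟩ := Finset.exists_subset_card_eq hAc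
    obtain ⟨f, hfl, hfn, hfY, hft⟩ := exists_tight_link (by omega)
      (Finset.sdiff_subset.trans hMW) h3 (e := e.toList) (by simpa using hec)
      (Finset.nodup_toList e) (fun v hv => hMW (hAM (heA (by simpa using hv)))) (k - 1) (by omega)
    exact ⟨e.toList, f, by simpa using hec, hfl, Finset.nodup_toList e,
      (List.nodup_append'.1 hfn).2.1, fun v hv => heA (by simpa using hv), hfY, hft⟩
  choose! e f hel hfl hen hfn heA hfA hef using hlink
  have hsum := sum_card_hamPaths_le (k := k) (E := E) hM hxyW hxy As (fun A hA => (hAs A hA).1) e f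
    (fun A hA => by rw [hel A hA]; omega) (fun A hA => by rw [hfl A hA]; omega) hef
  set K := 3 / 20 * √n with hK
  set c := n * Real.log n - n * Real.log 2 - L * n + √n + K with hc
  have hterm : ∀ A ∈ As, Real.exp c ≤ ((hamPaths k E (A ∪ x.toFinset) x (e A)).card *
      (hamPaths k E ((M \ A) ∪ y.toFinset) (f A) y).card : ℕ) := by
    intro A hA
    have hAM := (hAs A hA).1
    obtain ⟨h1, h2, h3, h4, -⟩ := hhalf A hA A (Or.inl rfl) x.toFinset _ hxc rfl hxW
    obtain ⟨h1', h2', h3', h4', -⟩ := hhalf A hA _ (Or.inr rfl) y.toFinset _ hyc rfl hyW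
    have hp := hrec _ h1 h2 h3 h4 x (e A) hx (hel A hA)
      (List.nodup_append'.2 ⟨(List.nodup_append'.1 hxy).1, hen A hA, fun v hv hv' =>
        (hMx v (hAM (heA A hA v hv'))).2.1 hv⟩)
      (fun v hv => by
        rcases List.mem_append.1 hv with h | h
        · simp [h]
        · simp [heA A hA v h])
    have hp' := hrec _ h1' h2' h3' h4' (f A) y (hfl A hA) hy
      (List.nodup_append'.2 ⟨hfn A hA, (List.nodup_append'.1 hxy).2.1, fun v hv hv' =>
        (hMx v (Finset.mem_sdiff.1 (hfA A hA v hv)).1).2.2 hv'⟩)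
      (fun v hv => by
        rcases List.mem_append.1 hv with h | h
        · exact Finset.mem_union_left _ (hfA A hA v h)
        · simp [h])
    have hcard : (A ∪ x.toFinset).card + ((M \ A) ∪ y.toFinset).card = W.card := by
      rw [Finset.card_union_of_disjoint, Finset.card_union_of_disjoint,
        Finset.card_sdiff_of_subset hAM, List.toFinset_card_of_nodup (List.nodup_append'.1 hxy).1,
        List.toFinset_card_of_nodup (List.nodup_append'.1 hxy).2.1]
      · have := Finset.card_le_card hAM
        omega
      · exact Finset.disjoint_left.2 fun v hv hv' =>
          (hMx v (Finset.mem_sdiff.1 hv).1).2.2 (by simpa using hv')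
      · exact Finset.disjoint_left.2 fun v hv hv' => (hMx v (hAM hv)).2.1 (by simpa using hv')
    have hcard' : ((A ∪ x.toFinset).card : ℝ) + (((M \ A) ∪ y.toFinset).card : ℝ) = n := by
      rw [hn]; exact_mod_cast hcard
    have hent := entropy_halving (a := ((A ∪ x.toFinset).card : ℝ))
      (b := (((M \ A) ∪ y.toFinset).card : ℝ)) (L := L) (K := K)
      (by exact_mod_cast (by omega : 0 < (A ∪ x.toFinset).card))
      (by exact_mod_cast (by omega : 0 < ((M \ A) ∪ y.toFinset).card))
      (by exact_mod_cast (by omega)) (by exact_mod_cast (by omega)) (by rw [hcard'])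
    rw [hcard', ← hc] at hent
    rw [Nat.cast_mul]
    refine (Real.exp_le_exp.2 hent).trans ?_
    rw [Real.exp_add]
    exact mul_le_mul hp hp' (Real.exp_nonneg _) (Nat.cast_nonneg _)
  have hAll : (As.card : ℝ) * Real.exp c ≤ (n + 1) * (hamPaths k E W x y).card := by
    rw [← nsmul_eq_mul]
    refine (Finset.card_nsmul_le_sum _ _ _ hterm).trans ?_
    rw [← Nat.cast_sum, hn]
    exact_mod_cast hsum
  have hAsc' : Real.exp (n * Real.log 2 - (2 * k + 1)) ≤ As.card := by
    refine le_trans ?_ hAsc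
    exact exp_le_two_pow_mul_half (by rw [hn]; exact_mod_cast hWM)
  have hn1 : n + 1 ≤ Real.exp (k * Real.log n + 1) :=
    add_one_le_exp_log (by rw [hn]; exact_mod_cast hW2) (by linarith)
  refine le_of_mul_le_mul_left (le_trans ?_ hAll) (by linarith : 0 < n + 1)
  calc (n + 1) * Real.exp (pathEntropy L n)
      ≤ Real.exp (k * Real.log n + 1) * Real.exp (pathEntropy L n) := by gcongr
    _ = Real.exp (k * Real.log n + 1 + pathEntropy L n) := (Real.exp_add _ _).symm
    _ ≤ Real.exp (n * Real.log 2 - (2 * k + 1) + c) := by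
      rw [Real.exp_le_exp, hc, hK, pathEntropy]
      have : 0 ≤ √n := Real.sqrt_nonneg n
      linarith
    _ = Real.exp (n * Real.log 2 - (2 * k + 1)) * Real.exp c := Real.exp_add _ _
    _ ≤ _ := by gcongr

end

theorem le_sqrt_sqrt {c s : ℝ} (h : c ^ 4 ≤ s) : c ≤ √√s := by
  refine Real.le_sqrt_of_sq_le (Real.le_sqrt_of_sq_le ?_)
  linarith [show (c ^ 2) ^ 2 = c ^ 4 by ring]

/-- Between any two prescribed ends there are exponentially in `s log s` many spanning tight
paths. -/
theorem exists_many_spanning_paths {k : ℕ} (hk : 2 ≤ k) {γ : ℝ} (hγ : 0 < γ) (hγ1 : γ ≤ 1 / 2) :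
    ∃ (L : ℝ) (n₀ : ℕ), ∀ {V : Type} [DecidableEq V] (E : Finset V → Prop) (W : Finset V),
      (∀ e, E e → e.card = k) → Good k E (1 / 2 + γ) W W → n₀ ≤ W.card → ∀ x y : List V,
      x.length = k - 1 → y.length = k - 1 → (x ++ y).Nodup → (∀ v ∈ x ++ y, v ∈ W) →
      Real.exp (W.card * Real.log W.card - L * W.card) ≤ (hamPaths k E W x y).card := by
  obtain ⟨n₁, hn₁⟩ := exists_spanning_path k hk (γ / 2) (by linarith) (by linarith)
  obtain ⟨n₂, hn₂⟩ := exists_forall_log_add_le_sqrt (k : ℝ) (2 * k + 2)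
    (show (0 : ℝ) < 1 / 3200 by norm_num)
  set c : ℝ := max (2 / γ) (80 * k + 4) with hc
  set N := max (max n₁ n₂) (max ⌈c ^ 4⌉₊ 1) with hN
  refine ⟨Real.log (3 * N) + 1, N, fun {V} _ E W hE hG hW x y hx hy hxy hxyW => ?_⟩
  have hroot : ∀ s : ℕ, N ≤ s → c ≤ √√(s : ℝ) := fun s hs =>
    le_sqrt_sqrt ((Nat.le_ceil _).trans (by exact_mod_cast le_trans (by simp [hN]) hs))
  have key : ∀ s : ℕ, N ≤ s → ∀ W : Finset V, W.card = s →
      Good k E (1 / 2 + (γ - 1 / √√(W.card : ℝ))) W W → ∀ x y : List V,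
      x.length = k - 1 → y.length = k - 1 → (x ++ y).Nodup → (∀ v ∈ x ++ y, v ∈ W) →
      Real.exp (pathEntropy (Real.log (3 * N) + 1) W.card) ≤ (hamPaths k E W x y).card := by
    intro s
    induction s using Nat.strong_induction_on with
    | _ s ih =>
      intro hs W hW hG x y hx hy hxy hxyW
      have hcs := hroot s hs
      have h1 : 2 / γ ≤ √√(W.card : ℝ) := by rw [hW]; exact (le_max_left _ _).trans hcs
      have h2 : 80 * k + 4 ≤ √√(W.card : ℝ) := by rw [hW]; exact (le_max_right _ _).trans hcs
      by_cases h3 : s < 3 * N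
      · have hr0 : 0 < √√(W.card : ℝ) := lt_of_lt_of_le (by positivity) h1
        have h4 : 1 / √√(W.card : ℝ) ≤ γ / 2 := by
          rw [div_le_iff₀ hγ] at h1
          rw [div_le_iff₀ hr0]; linarith
        obtain ⟨l, hl, hln, hlW⟩ := hn₁ E W hE (hG.mono (by linarith))
          (le_trans (by simp [hN]) (hs.trans hW.ge)) x y hx hy hxy hxyW
        have h5 : x ++ l ++ y ∈ hamPaths k E W x y := by
          rw [mem_hamPaths]
          exact ⟨hln, Finset.ext fun v => by rw [List.mem_toFinset, hlW], hl,
            ⟨l ++ y, by simp⟩, ⟨x ++ l, rfl⟩⟩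
        have h6 : (1 : ℝ) ≤ (hamPaths k E W x y).card := by
          exact_mod_cast Finset.card_pos.2 ⟨_, h5⟩
        refine le_trans (Real.exp_le_one_iff.2 ?_) h6
        have hs1 : (1 : ℝ) ≤ s := by exact_mod_cast le_trans (by simp [hN]) hs
        have h7 : Real.log s ≤ Real.log (3 * N) :=
          Real.log_le_log (by linarith) (by exact_mod_cast h3.le)
        have h8 : √(s : ℝ) ≤ s := by
          rw [Real.sqrt_le_left (by linarith)]
          nlinarith
        rw [hW, pathEntropy]
        nlinarith
      · refine exp_pathEntropy_le_card hk hγ hγ1 h2 h1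
          (hn₂ _ (le_trans (by simp [hN]) (hs.trans hW.ge))) hG ?_ hx hy hxy hxyW
        intro W' _ h4 h5 h6 x y hx hy hxy hxyW
        exact ih W'.card (by omega) (by omega) W' rfl h6 x y hx hy hxy hxyW
  refine le_trans (Real.exp_le_exp.2 ?_) (key W.card hW W rfl (hG.mono ?_) x y hx hy hxy hxyW)
  · rw [pathEntropy]
    linarith [Real.sqrt_nonneg (W.card : ℝ)]
  · have : 0 ≤ 1 / √√(W.card : ℝ) := by positivity
    linarith

theorem factorial_mul_two_pow_le {n : ℕ} (hn : 1 ≤ n) :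
    n.factorial * 2 ^ n ≤ 2 * n ^ n := by
  induction n, hn using Nat.le_induction with
  | base => simp
  | succ n hn ih =>
    have h : 2 * n ^ n ≤ (n + 1) ^ n := by
      have h1 := pow_add_mul_le_add_pow (a := n) (b := 1) (Nat.zero_le _) (by omega) n
      have h2 : n * n ^ (n - 1) = n ^ n := by
        rw [← pow_succ', Nat.sub_add_cancel hn]
      simp only [Nat.cast_id, mul_one] at h1
      linarith
    rw [Nat.factorial_succ]
    calc (n + 1) * n.factorial * 2 ^ (n + 1) = 2 * (n + 1) * (n.factorial * 2 ^ n) := by ring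
      _ ≤ 2 * (n + 1) * (2 * n ^ n) := by gcongr
      _ ≤ 2 * (n + 1) * (n + 1) ^ n := by gcongr
      _ = _ := by ring

theorem factorial_le_exp {n : ℕ} (hn : 2 ≤ n) :
    (n.factorial : ℝ) ≤ Real.exp (n * Real.log n - Real.log 2 / 2 * n) := by
  have h1 : (n.factorial : ℝ) * 2 ^ n ≤ 2 * n ^ n := by
    exact_mod_cast factorial_mul_two_pow_le (by omega)
  have hn' : (2 : ℝ) ≤ n := by exact_mod_cast hn
  have h2 : (2 : ℝ) ^ n = Real.exp (n * Real.log 2) := by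
    rw [Real.exp_nat_mul, Real.exp_log (by norm_num)]
  have h3 : (n : ℝ) ^ n = Real.exp (n * Real.log n) := by
    rw [Real.exp_nat_mul, Real.exp_log (by linarith)]
  have h4 : (2 : ℝ) * n ^ n = Real.exp (Real.log 2 + n * Real.log n) := by
    rw [h3, Real.exp_add, Real.exp_log (by norm_num)]
  have h5 : 0 ≤ Real.log 2 := Real.log_nonneg (by norm_num)
  refine le_of_mul_le_mul_right ?_ (by positivity : (0 : ℝ) < 2 ^ n)
  refine h1.trans ?_
  rw [h4, h2, ← Real.exp_add, Real.exp_le_exp]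
  nlinarith

theorem card_chain_le {V : Type} {N : V → Finset V} {d : ℕ} (hN : ∀ v, (N v).card ≤ d) (m : ℕ)
    (a : V) (s : Finset (List V))
    (hs : ∀ l ∈ s, l.length = m ∧ List.IsChain (fun u v => v ∈ N u) (a :: l)) :
    s.card ≤ d ^ m := by
  induction m generalizing a s with
  | zero =>
    rw [pow_zero]
    refine Finset.card_le_one.2 fun l hl l' hl' => ?_
    rw [List.length_eq_zero_iff.1 (hs l hl).1, List.length_eq_zero_iff.1 (hs l' hl').1]
  | succ m ih =>
    rw [pow_succ]
    refine (Finset.card_le_mul_card_image_of_maps_to (f := fun l => l.headD a) (t := N a)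
      (fun l hl => ?_) (d ^ m) fun b _ => ?_).trans (by gcongr; exact hN a)
    · obtain ⟨h1, h2⟩ := hs l hl
      obtain ⟨b, l, rfl⟩ := List.exists_cons_of_length_eq_add_one h1
      exact (List.isChain_cons_cons.1 h2).1
    · have hcons : ∀ l ∈ s.filter (fun l => l.headD a = b), ∃ t, l = b :: t := by
        intro l hl
        obtain ⟨h1, h2⟩ := Finset.mem_filter.1 hl
        obtain ⟨c, l, rfl⟩ := List.exists_cons_of_length_eq_add_one (hs l h1).1
        exact ⟨l, by rw [← h2]; rfl⟩
      rw [← Finset.card_image_of_injOn (f := List.tail) fun l hl l' hl' h => ?_]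
      · refine ih b _ fun l hl => ?_
        obtain ⟨l', hl', rfl⟩ := Finset.mem_image.1 hl
        obtain ⟨t, rfl⟩ := hcons l' hl'
        obtain ⟨h1, h2⟩ := hs _ (Finset.mem_filter.1 hl').1
        exact ⟨by simpa using h1, (List.isChain_cons_cons.1 h2).2⟩
      · obtain ⟨t, rfl⟩ := hcons l hl
        obtain ⟨t', rfl⟩ := hcons l' hl'
        simpa using h

section

variable {n k : ℕ}

/-- The edge set of the tight cycle with cyclic ordering `v`. -/
def cycleEdges (k : ℕ) (v : Fin n → Fin n) : Finset (Finset (Fin n)) :=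
  Finset.univ.image fun i : Fin n => Finset.univ.image fun j : Fin k =>
    v ⟨((i : ℕ) + (j : ℕ)) % n, Nat.mod_lt _ i.pos⟩

theorem mem_tightHamCycles {E C : Finset (Finset (Fin n))} :
    C ∈ tightHamCycles n k E ↔
      C ⊆ E ∧ ∃ v : Fin n → Fin n, v.Bijective ∧ C = cycleEdges k v := by
  rw [tightHamCycles, Finset.mem_filter, Finset.mem_powerset]
  congr!

theorem card_tightHamCycles_le (E : Finset (Finset (Fin n))) :
    (tightHamCycles n k E).card ≤ n.factorial := by
  have h : tightHamCycles n k E ⊆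
      Finset.univ.image fun v : Equiv.Perm (Fin n) => cycleEdges k v := by
    intro C hC
    obtain ⟨-, v, hv, rfl⟩ := mem_tightHamCycles.1 hC
    exact Finset.mem_image.2 ⟨Equiv.ofBijective v hv, Finset.mem_univ _, rfl⟩
  refine (Finset.card_le_card h).trans (Finset.card_image_le.trans ?_)
  rw [Finset.card_univ, Fintype.card_perm, Fintype.card_fin]

/-- The vertices sharing a member of `C` with `u`. -/
def nhd {V : Type} [DecidableEq V] (C : Finset (Finset V)) (u : V) : Finset V :=
  (C.filter (u ∈ ·)).biUnion id

theorem mem_nhd {V : Type} [DecidableEq V] {C : Finset (Finset V)} {u w : V} :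
    w ∈ nhd C u ↔ ∃ e ∈ C, u ∈ e ∧ w ∈ e := by
  simp [nhd, and_assoc]

theorem card_nhd_cycleEdges_le {v : Fin n → Fin n} (hv : v.Bijective) (hkn : k ≤ n) (u : Fin n) :
    (nhd (cycleEdges k v) u).card ≤ k ^ 2 := by
  obtain ⟨m, rfl⟩ := hv.2 u
  have h : nhd (cycleEdges k v) (v m) ⊆ Finset.univ.image fun p : Fin k × Fin k =>
      v ⟨((m : ℕ) + n - p.1 + p.2) % n, Nat.mod_lt _ m.pos⟩ := by
    intro w hw
    obtain ⟨e, he, hme, hwe⟩ := mem_nhd.1 hw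
    obtain ⟨i, -, rfl⟩ := Finset.mem_image.1 he
    obtain ⟨j, -, hj⟩ := Finset.mem_image.1 hme
    obtain ⟨j', -, rfl⟩ := Finset.mem_image.1 hwe
    refine Finset.mem_image.2 ⟨(j, j'), Finset.mem_univ _, ?_⟩
    have hj' := congrArg Fin.val (hv.1 hj)
    simp only at hj' ⊢
    congr 2
    have h1 := Nat.div_add_mod ((i : ℕ) + j) n
    have h2 := j.2
    rw [← Nat.add_mul_mod_self_left _ n (((i : ℕ) + j) / n), ← Nat.add_mod_right ((i : ℕ) + j')]
    congr 1
    omega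
  refine (Finset.card_le_card h).trans (Finset.card_image_le.trans ?_)
  simp [sq]

theorem mem_nhd_cycleEdges (hk : 2 ≤ k) (v : Fin n → Fin n) {i : ℕ} (hi : i + 1 < n) :
    v ⟨i + 1, hi⟩ ∈ nhd (cycleEdges k v) (v ⟨i, by omega⟩) := by
  refine mem_nhd.2 ⟨_, Finset.mem_image.2 ⟨⟨i, by omega⟩, Finset.mem_univ _, rfl⟩,
    Finset.mem_image.2 ⟨⟨0, by omega⟩, Finset.mem_univ _, ?_⟩,
    Finset.mem_image.2 ⟨⟨1, by omega⟩, Finset.mem_univ _, ?_⟩⟩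
  · congr 2
    exact Nat.mod_eq_of_lt (Nat.lt_of_succ_lt hi)
  · congr 2
    exact Nat.mod_eq_of_lt hi

/-- The enumeration of `Fin n` given by a list of length `n`. -/
def enum (l : List (Fin n)) (i : Fin n) : Fin n := l.getD i i

theorem enum_eq {l : List (Fin n)} (hl : l.length = n) {i : ℕ} (hi : i < n) :
    enum l ⟨i, hi⟩ = l[i] := by
  rw [enum, List.getD_eq_getElem _ _ (by omega)]

theorem enum_bijective {l : List (Fin n)} (hl : l.length = n) (hn : l.Nodup) :
    (enum l).Bijective := by
  refine Finite.injective_iff_bijective.1 fun i j h => ?_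
  rw [enum_eq hl i.2, enum_eq hl j.2, hn.getElem_inj_iff] at h
  exact Fin.ext h

theorem cycleEdges_subset {E : Finset (Finset (Fin n))} {l x : List (Fin n)} (hl : l.length = n)
    (hx : x.length = k - 1) (hxl : x <+: l) (h : Tight k (· ∈ E) (l ++ x)) :
    cycleEdges k (enum l) ⊆ E := by
  intro e he
  obtain ⟨i, -, rfl⟩ := Finset.mem_image.1 he
  have hw : ((l ++ x).drop i).take k = List.ofFn fun j : Fin k =>
      enum l ⟨((i : ℕ) + (j : ℕ)) % n, Nat.mod_lt _ i.pos⟩ := by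
    refine List.ext_getElem (by simp; omega) fun j h1 h2 => ?_
    have hj : j < k := by simpa using h2
    have hxn := hxl.length_le
    rw [List.getElem_take, List.getElem_drop, List.getElem_ofFn, enum_eq hl]
    by_cases hij : i + j < n
    · rw [List.getElem_append_left (by omega)]
      simp only [Nat.mod_eq_of_lt hij]
    · rw [List.getElem_append_right (by omega), hxl.getElem]
      have : ((i : ℕ) + j) % n = i + j - n := by
        rw [Nat.mod_eq_sub_mod (by omega), Nat.mod_eq_of_lt (by omega)]
      simp only [this, hl]
  have := h _ ((List.take_prefix _ _).isInfix.trans (List.drop_suffix _ _).isInfix)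
    (by rw [hw, List.length_ofFn])
  rw [hw] at this
  convert this using 1
  ext u
  simp [List.mem_ofFn]

theorem card_le_mul_card_tightHamCycles (hk : 2 ≤ k) (hkn : k ≤ n) {E : Finset (Finset (Fin n))}
    {x y : List (Fin n)} (hx : x.length = k - 1) (hy : y.length = k - 1)
    (hyx : Tight k (· ∈ E) (y ++ x)) :
    (hamPaths k (· ∈ E) Finset.univ x y).card ≤ (k ^ 2) ^ (n - 1) * (tightHamCycles n k E).card := by
  have hlen : ∀ l ∈ hamPaths k (· ∈ E) Finset.univ x y, l.length = n := fun l hl => by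
    obtain ⟨h1, h2, -⟩ := mem_hamPaths.1 hl
    rw [← List.toFinset_card_of_nodup h1, h2, Finset.card_univ, Fintype.card_fin]
  refine Finset.card_le_mul_card_image_of_maps_to (f := fun l => cycleEdges k (enum l))
    (fun l hl => ?_) _ fun C hC => ?_
  · obtain ⟨h1, h2, h3, h4, p, rfl⟩ := mem_hamPaths.1 hl
    refine mem_tightHamCycles.2 ⟨cycleEdges_subset (hlen _ hl) hx h4 ?_, _,
      enum_bijective (hlen _ hl) h1, rfl⟩
    exact Tight.append (by omega) h3 hyx
  · obtain ⟨a, x, rfl⟩ := List.exists_cons_of_ne_nil (List.ne_nil_of_length_pos (by omega : 0 < x.length))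
    obtain ⟨-, v, hv, rfl⟩ := mem_tightHamCycles.1 hC
    set s := (hamPaths k (· ∈ E) Finset.univ (a :: x) y).filter
      fun l => cycleEdges k (enum l) = cycleEdges k v with hs
    have hcons : ∀ l ∈ s, ∃ t, l = a :: t := by
      intro l hl
      obtain ⟨t, rfl⟩ := (mem_hamPaths.1 (Finset.mem_filter.1 hl).1).2.2.2.1
      exact ⟨x ++ t, rfl⟩
    rw [← Finset.card_image_of_injOn (f := List.tail) fun l hl l' hl' h => ?_]
    · refine card_chain_le (card_nhd_cycleEdges_le hv hkn) _ a _ fun l hl => ?_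
      obtain ⟨l', hl', rfl⟩ := Finset.mem_image.1 hl
      obtain ⟨t, rfl⟩ := hcons l' hl'
      obtain ⟨h1, h2⟩ := Finset.mem_filter.1 hl'
      have h3 := hlen _ h1
      refine ⟨by simp at h3; simp; omega, List.isChain_iff_getElem.2 fun i hi => ?_⟩
      have hi' : i + 1 < n := by simp at h3 hi; omega
      have := mem_nhd_cycleEdges hk (enum (a :: t)) hi'
      rwa [h2, enum_eq h3, enum_eq h3] at this
    · obtain ⟨t, rfl⟩ := hcons l hl
      obtain ⟨t', rfl⟩ := hcons l' hl'
      simpa using h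

theorem good_of_codegree {E : Finset (Finset (Fin n))} (hk : 1 ≤ k) (hE : ∀ e ∈ E, e.card = k)
    {η : ℝ} (h : ∀ S : Finset (Fin n), S.card = k - 1 →
      η * (n : ℝ) ≤ ((E.filter (fun e => S ⊆ e)).card : ℝ)) :
    Good k (· ∈ E) η Finset.univ Finset.univ := by
  intro S _ hS
  rw [Finset.card_univ, Fintype.card_fin]
  refine (h S hS).trans ?_
  have h1 : E.filter (fun e => S ⊆ e) ⊆ (nbr (· ∈ E) S Finset.univ).image (insert · S) := by
    intro e he
    obtain ⟨h1, h2⟩ := Finset.mem_filter.1 he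
    obtain ⟨v, -, rfl⟩ := Finset.exists_eq_insert_iff.2 ⟨h2, by rw [hE e h1, hS]; omega⟩
    exact Finset.mem_image.2 ⟨v, by simpa [nbr] using h1, rfl⟩
  exact_mod_cast (Finset.card_le_card h1).trans Finset.card_image_le

end

theorem exists_exp_le_card_tightHamCycles {k : ℕ} (hk : 2 ≤ k) {γ : ℝ} (hγ : 0 < γ)
    (hγ1 : γ ≤ 1 / 2) : ∃ (c : ℝ) (n₀ : ℕ), ∀ n, n₀ ≤ n → ∀ E : Finset (Finset (Fin n)),
      (∀ e ∈ E, e.card = k) → Good k (· ∈ E) (1 / 2 + γ) Finset.univ Finset.univ →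
      Real.exp (n * Real.log n - c * n) ≤ (tightHamCycles n k E).card := by
  obtain ⟨L, N, hN⟩ := exists_many_spanning_paths hk hγ hγ1
  refine ⟨L + Real.log (k ^ 2), max N (4 * k), fun n hn E hE hG => ?_⟩
  have hkn : 4 * k ≤ n := (le_max_right _ _).trans hn
  have hc : (Finset.univ : Finset (Fin n)).card = n := by simp
  have hkn' : (4 : ℝ) * k ≤ n := by exact_mod_cast hkn
  have hdeg : ∀ S ⊆ (Finset.univ : Finset (Fin n)), S.card = k - 1 →
      2 * k ≤ (nbr (· ∈ E) S Finset.univ).card := by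
    intro S hS hSk
    have h1 := hG S hS hSk
    rw [hc] at h1
    have h2 : (2 : ℝ) * k ≤ (nbr (· ∈ E) S Finset.univ).card := by
      refine le_trans ?_ h1
      nlinarith
    exact_mod_cast h2
  obtain ⟨s, -, hs⟩ := Finset.exists_subset_card_eq
    (show k - 1 ≤ (Finset.univ : Finset (Fin n)).card by rw [hc]; omega)
  obtain ⟨x, hx, hxn, -, ht⟩ := exists_tight_link (by omega) subset_rfl hdeg (e := s.toList)
    (by simpa using hs) (Finset.nodup_toList s) (by simp) (k - 1) (by omega)
  have hy : s.toList.length = k - 1 := by simpa using hs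
  have h1 := hN (· ∈ E) Finset.univ hE hG (by rw [hc]; exact (le_max_left _ _).trans hn) x s.toList
    hx hy (List.perm_append_comm.nodup_iff.1 hxn) (by simp)
  rw [hc] at h1
  have h2 : ((hamPaths k (· ∈ E) Finset.univ x s.toList).card : ℝ) ≤
      ((k : ℝ) ^ 2) ^ (n - 1) * (tightHamCycles n k E).card := by
    exact_mod_cast card_le_mul_card_tightHamCycles hk (by omega) hx hy ht
  have hk1 : (1 : ℝ) ≤ (k : ℝ) ^ 2 := one_le_pow₀ (by exact_mod_cast (by omega : 1 ≤ k))
  have h3 : ((k : ℝ) ^ 2) ^ (n - 1) ≤ Real.exp (n * Real.log (k ^ 2)) := by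
    rw [Real.exp_nat_mul, Real.exp_log (by linarith)]
    exact pow_le_pow_right₀ hk1 (by omega)
  refine le_of_mul_le_mul_left ?_ (Real.exp_pos (n * Real.log (k ^ 2)))
  calc Real.exp (n * Real.log (k ^ 2)) * Real.exp (n * Real.log n - (L + Real.log (k ^ 2)) * n)
      = Real.exp (n * Real.log n - L * n) := by
        rw [← Real.exp_add]
        ring_nf
    _ ≤ _ := h1.trans (h2.trans (by gcongr))

end TightHam

/-- For every integer `k ≥ 2` and every `γ > 0` there exist constants `c₁, c₂ > 0` and
`n₀` such that for all `n ≥ n₀`, every `k`-graph on `n` vertices with minimum codegree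
at least `(1/2 + γ)n` contains at least `exp(n ln n − c₂ n)` and at most
`exp(n ln n − c₁ n)` tight Hamilton cycles. -/
theorem stmt_0 :
    ∀ k : ℕ, 2 ≤ k → ∀ γ : ℝ, 0 < γ →
    ∃ c₁ c₂ : ℝ, 0 < c₁ ∧ 0 < c₂ ∧ ∃ n₀ : ℕ, ∀ n : ℕ, n₀ ≤ n →
    ∀ E : Finset (Finset (Fin n)),
      (∀ e ∈ E, e.card = k) →
      (∀ S : Finset (Fin n), S.card = k - 1 →
        (1/2 + γ) * (n : ℝ) ≤ ((E.filter (fun e => S ⊆ e)).card : ℝ)) →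
      Real.exp ((n : ℝ) * Real.log n - c₂ * n) ≤ ((tightHamCycles n k E).card : ℝ) ∧
      ((tightHamCycles n k E).card : ℝ) ≤ Real.exp ((n : ℝ) * Real.log n - c₁ * n) := by
  intro k hk γ hγ
  obtain ⟨c, N, h⟩ := TightHam.exists_exp_le_card_tightHamCycles hk
    (lt_min hγ (by norm_num : (0 : ℝ) < 1 / 2)) (min_le_right _ _)
  refine ⟨Real.log 2 / 2, max c 1, half_pos (Real.log_pos (by norm_num)), by positivity, max N 2,
    fun n hn E hE hdeg => ⟨?_, ?_⟩⟩
  · have hG := (TightHam.good_of_codegree (by omega) hE hdeg).mono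
      (add_le_add_right (min_le_left γ (1 / 2)) (1 / 2))
    refine le_trans (Real.exp_le_exp.2 ?_) (h n ((le_max_left _ _).trans hn) E hE hG)
    have := mul_le_mul_of_nonneg_right (le_max_left c 1) (Nat.cast_nonneg (α := ℝ) n)
    linarith
  · refine le_trans ?_ (TightHam.factorial_le_exp ((le_max_right _ _).trans hn))
    exact_mod_cast TightHam.card_tightHamCycles_le E
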